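/- arXiv:math/0603231 — 5 statements merged into one kernel-verified Lean document; each statement's English description precedes it below -/
import Mathlib

section
/- Let G = G(r,p,n) act on V = ℂ^n with basis v_1,…,v_n and contragrediently on V^* with dual basis x_1,…,x_n. Define θ_j = Σ_{i=1}^n v_i^{(j−1)r+1} ⊗ x_i for 1 ≤ j ≤ n−1, and θ_n = Σ_{i=1}^n v_i^{(n−1)r+1} ⊗ x_i if p ≠ r, while θ_n = Σ_{i=1}^n (v_1⋯v_{i−1}v_{i+1}⋯v_n)^{r−1} ⊗ x_i if p = r. Then for every k with 1 ≤ k ≤ n, the G(r,p,n)-invariants of S(V) ⊗ ⋀^k(V^*) (under the diagonal action) form the free S(V)^{G(r,p,n)}-module with basis the wedge products θ_{i_1} ∧ ⋯ ∧ θ_{i_k} for 1 ≤ i_1 < ⋯ < i_k ≤ n: (S(V) ⊗ ⋀^k(V^*))^{G(r,p,n)} = ⨁_{1≤i_1<⋯<i_k≤n} S(V)^{G(r,p,n)} · (θ_{i_1} ∧ ⋯ ∧ θ_{i_k}). -/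
open MvPolynomial Matrix Finset

attribute [local instance] Classical.propDecidable

noncomputable section

/-- The group `G(r,p,n)` of monomial `n×n` matrices whose nonzero entries are `r`-th roots
of unity and such that the product of the nonzero entries raised to the `r/p` power is `1`.
(For a monomial matrix the product of the nonzero entries is `∏ i, ∑ j, M i j`.) -/
def GG (r p n : ℕ) : Set (Matrix (Fin n) (Fin n) ℂ) :=
  {M | (∃ (σ : Equiv.Perm (Fin n)) (d : Fin n → ℂ),
          (∀ j, d j ^ r = 1) ∧ ∀ i j, M i j = if i = σ j then d j else 0) ∧
       (∏ i, ∑ j, M i j) ^ (r / p) = 1}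

/-- The centralizer of `g` in `G(r,p,n)`. -/
def Zg (r p n : ℕ) (g : Matrix (Fin n) (Fin n) ℂ) : Set (Matrix (Fin n) (Fin n) ℂ) :=
  {h | h ∈ GG r p n ∧ h * g = g * h}

/-- The action of a matrix `M` on `S(V) = ℂ[v_1,…,v_n]`, sending the variable `X j`
(the `j`-th basis vector of `V`) to the linear form corresponding to `M · e_j`. -/
def act {n : ℕ} (M : Matrix (Fin n) (Fin n) ℂ) :
    MvPolynomial (Fin n) ℂ →ₐ[ℂ] MvPolynomial (Fin n) ℂ :=
  aeval fun j => ∑ i, C (M i j) * X i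

/-- `S(V^g)`: the subalgebra of `S(V)` generated by the linear forms corresponding to
vectors fixed by `g`. -/
def SVg {n : ℕ} (g : Matrix (Fin n) (Fin n) ℂ) : Subalgebra ℂ (MvPolynomial (Fin n) ℂ) :=
  Algebra.adjoin ℂ {q | ∃ c : Fin n → ℂ, g.mulVec c = c ∧ q = ∑ i, C (c i) * X i}

/-- The fixed space `V^g` inside Euclidean space `ℂⁿ`. -/
def fixedSpace {n : ℕ} (M : Matrix (Fin n) (Fin n) ℂ) :
    Submodule ℂ (EuclideanSpace ℂ (Fin n)) :=
  LinearMap.ker (Matrix.toEuclideanLin M - LinearMap.id)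

/-- The determinant of the restriction of an endomorphism to an invariant subspace
(junk value `0` if the subspace is not invariant). -/
def detOn {n : ℕ} (f : EuclideanSpace ℂ (Fin n) →ₗ[ℂ] EuclideanSpace ℂ (Fin n))
    (W : Submodule ℂ (EuclideanSpace ℂ (Fin n))) : ℂ :=
  if h : ∀ x ∈ W, f x ∈ W then LinearMap.det (f.restrict h) else 0

/-- The Hochschild character `χ_g(h) = det(h^⊥)`: the determinant of `h` restricted to the
orthogonal complement of the fixed space `V^g`. -/
def chi {n : ℕ} (g h : Matrix (Fin n) (Fin n) ℂ) : ℂ :=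
  detOn (Matrix.toEuclideanLin h) (fixedSpace g)ᗮ

/-- The permutation matrix underlying a monomial matrix (entrywise: replace each nonzero
entry by `1`); applying `act ∘ rho` realizes the nonfaithful representation `ρ`,
which factors through the quotient map to the symmetric group. -/
def rho {n : ℕ} (M : Matrix (Fin n) (Fin n) ℂ) : Matrix (Fin n) (Fin n) ℂ :=
  Matrix.of fun i j => if M i j = 0 then 0 else 1

/-- The element `∑ i, c i ⊗ x i` of `S(V) ⊗ V^*`, viewed as a linear map `V → S(V)`. -/
def oneForm {n : ℕ} (c : Fin n → MvPolynomial (Fin n) ℂ) :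
    EuclideanSpace ℂ (Fin n) →ₗ[ℂ] MvPolynomial (Fin n) ℂ where
  toFun w := ∑ i, w i • c i
  map_add' u v := by
    simp [PiLp.add_apply, add_smul, Finset.sum_add_distrib]
  map_smul' a u := by
    simp [PiLp.smul_apply, smul_smul, Finset.smul_sum]

/-- The wedge product `φ 0 ∧ ⋯ ∧ φ (k-1)` of `k` elements of `S(V) ⊗ V^*`, as an
alternating `k`-multilinear map `V^k → S(V)`, i.e. an element of `S(V) ⊗ ⋀^k (V^*)`. -/
def wedge {n : ℕ} (k : ℕ)
    (φ : Fin k → (EuclideanSpace ℂ (Fin n) →ₗ[ℂ] MvPolynomial (Fin n) ℂ)) :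
    (EuclideanSpace ℂ (Fin n)) [⋀^Fin k]→ₗ[ℂ] MvPolynomial (Fin n) ℂ :=
  AlternatingMap.compLinearMap
    { toMultilinearMap :=
        (Matrix.detRowAlternating (R := MvPolynomial (Fin n) ℂ)
            (n := Fin k)).toMultilinearMap.restrictScalars ℂ
      map_eq_zero_of_eq' := fun v _ _ hv hij =>
        (Matrix.detRowAlternating (R := MvPolynomial (Fin n) ℂ)).map_eq_zero_of_eq v hv hij }
    (LinearMap.pi φ)

/-- The basic derivations `θ_j` of `G(r,p,n)`:
`θ_j = ∑ i, v_i^{(j−1)r+1} ⊗ x_i` for `1 ≤ j ≤ n−1` (here `j : Fin n` is the `(j+1)`-st),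
while `θ_n = ∑ i, v_i^{(n−1)r+1} ⊗ x_i` if `p ≠ r` and
`θ_n = ∑ i, (v₁⋯v_{i−1}v_{i+1}⋯v_n)^{r−1} ⊗ x_i` if `p = r`. -/
def theta (r p n : ℕ) (j : Fin n) :
    EuclideanSpace ℂ (Fin n) →ₗ[ℂ] MvPolynomial (Fin n) ℂ :=
  if (j : ℕ) = n - 1 ∧ p = r then
    oneForm fun i => ∏ t ∈ Finset.univ.erase i, X t ^ (r - 1)
  else
    oneForm fun i => X i ^ ((j : ℕ) * r + 1)

theorem alternatingMap_sum_apply {R M N ι κ : Type*} [Semiring R] [AddCommMonoid M] [Module R M]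
    [AddCommMonoid N] [Module R N] (s : Finset κ) (F : κ → M [⋀^ι]→ₗ[R] N) (x : ι → M) :
    (∑ i ∈ s, F i) x = ∑ i ∈ s, F i x := by
  induction s using Finset.induction_on with
  | empty => simp
  | insert a s ha ih => rw [Finset.sum_insert ha, Finset.sum_insert ha, AlternatingMap.add_apply, ih]

/-- Two alternating maps agree on a tuple drawn from a linearly ordered family as soon as they
agree on strictly increasing tuples. -/
theorem alternating_eq_of_strictMono {R M N : Type*} [CommRing R] [AddCommGroup M] [Module R M]
    [AddCommGroup N] [Module R N] {k n : ℕ} (F G : M [⋀^Fin k]→ₗ[R] N) (v : Fin n → M)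
    (h : ∀ g : Fin k → Fin n, StrictMono g → F (v ∘ g) = G (v ∘ g)) (g : Fin k → Fin n) :
    F (v ∘ g) = G (v ∘ g) := by
  by_cases hg : Function.Injective g
  · have hs : StrictMono (g ∘ Tuple.sort g) :=
      (Tuple.monotone_sort g).strictMono_of_injective (hg.comp (Tuple.sort g).injective)
    have h1 := h _ hs
    rw [← Function.comp_assoc, AlternatingMap.map_perm, AlternatingMap.map_perm] at h1
    exact smul_left_cancel _ h1
  · have hv : ¬ Function.Injective (v ∘ g) := fun hi => hg hi.of_comp
    rw [F.map_eq_zero_of_not_injective _ hv, G.map_eq_zero_of_not_injective _ hv]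

theorem det_delta_of_strictMono {R : Type*} [CommRing R] {k n : ℕ} (c : R)
    {I J : Fin k → Fin n} (hI : StrictMono I) (hJ : StrictMono J) :
    (Matrix.of fun a b => if I b = J a then c else 0 : Matrix (Fin k) (Fin k) R).det =
      if I = J then c ^ k else 0 := by
  split_ifs with h
  · subst h
    have : (Matrix.of fun a b => if I b = I a then c else 0 : Matrix (Fin k) (Fin k) R) =
        Matrix.diagonal fun _ => c := by
      ext a b
      simp only [Matrix.of_apply, Matrix.diagonal_apply, hI.injective.eq_iff, eq_comm (a := b)]
    rw [this, Matrix.det_diagonal]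
    simp
  · have hex : ∃ a, ∀ b, I b ≠ J a := by
      by_contra! hcon
      have hsub : Set.range J ⊆ Set.range I := by
        rintro _ ⟨a, rfl⟩
        exact hcon a
      have heq : Set.range J = Set.range I := by
        refine Set.eq_of_subset_of_ncard_le hsub ?_ (Set.toFinite _)
        rw [Set.ncard_range_of_injective hI.injective, Set.ncard_range_of_injective hJ.injective]
      exact h ((hJ.range_inj hI).1 heq).symm
    obtain ⟨a, ha⟩ := hex
    exact Matrix.det_eq_zero_of_row_eq_zero a fun b => by simp [ha b]

/-- The wedge product of the rows of `A` indexed by `I`, as an alternating form over `R`. -/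
def rowWedge {R : Type*} [CommRing R] {k n : ℕ} (A : Matrix (Fin n) (Fin n) R)
    (I : Fin k → Fin n) : (Fin n → R) [⋀^Fin k]→ₗ[R] R :=
  Matrix.detRowAlternating.compLinearMap ((LinearMap.funLeft R R I).comp A.mulVecLin)

theorem rowWedge_apply {R : Type*} [CommRing R] {k n : ℕ} (A : Matrix (Fin n) (Fin n) R)
    (I : Fin k → Fin n) (x : Fin k → Fin n → R) :
    rowWedge A I x = (Matrix.of fun a b => A.mulVec (x a) (I b)).det := rfl

theorem rowWedge_adjugate {R : Type*} [CommRing R] {k n : ℕ} (A : Matrix (Fin n) (Fin n) R)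
    {I J : Fin k → Fin n} (hI : StrictMono I) (hJ : StrictMono J) :
    rowWedge A I (A.adjugate.col ∘ J) = if I = J then A.det ^ k else 0 := by
  rw [rowWedge_apply, ← det_delta_of_strictMono A.det hI hJ]
  congr 1
  ext a b
  have h : A.mulVec (A.adjugate.col (J a)) = (A * A.adjugate).col (J a) := rfl
  rw [Matrix.of_apply, Function.comp_apply, h, Matrix.mul_adjugate]
  simp [Matrix.one_apply]

/-- An alternating form is determined by its values on the columns of the adjugate. -/
theorem alternating_eq_zero_of_adjugate {R : Type*} [CommRing R] [IsDomain R] {k n : ℕ}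
    (A : Matrix (Fin n) (Fin n) R) (hA : A.det ≠ 0) (F : (Fin n → R) [⋀^Fin k]→ₗ[R] R)
    (h : ∀ J : Fin k → Fin n, StrictMono J → F (A.adjugate.col ∘ J) = 0) : F = 0 := by
  have h0 : ∀ J : Fin k → Fin n, F (A.adjugate.col ∘ J) = 0 := fun J =>
    alternating_eq_of_strictMono F 0 _ (fun g hg => by simpa using h g hg) J
  refine Module.Basis.ext_alternating (Pi.basisFun R (Fin n)) fun v _ => ?_
  have h1 : (fun i => A.det • (Pi.basisFun R (Fin n)) (v i)) =
      fun i => ∑ j, A j (v i) • A.adjugate.col j := by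
    funext i t
    have := congrFun (congrFun (Matrix.adjugate_mul A) t) (v i)
    rw [Matrix.mul_apply] at this
    simp only [Finset.sum_apply, Pi.smul_apply, Matrix.col_apply, smul_eq_mul,
      Pi.basisFun_apply]
    rw [Finset.sum_congr rfl fun j _ => mul_comm (A j (v i)) _, this]
    simp [Matrix.one_apply, Pi.single_apply]
  have h2 : F (fun i => A.det • (Pi.basisFun R (Fin n)) (v i)) = 0 := by
    rw [h1]
    refine (F.toMultilinearMap.map_sum _).trans (Finset.sum_eq_zero fun g _ => ?_)
    refine (F.toMultilinearMap.map_smul_univ (fun i => A (g i) (v i))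
      (fun i => A.adjugate.col (g i))).trans ?_
    have := h0 g
    simp only [Function.comp_def] at this
    simp [this]
  have h3 := F.toMultilinearMap.map_smul_univ (fun _ => A.det)
    (fun i => (Pi.basisFun R (Fin n)) (v i))
  simp only [AlternatingMap.coe_multilinearMap, Finset.prod_const, Finset.card_univ, smul_eq_mul,
    Fintype.card_fin] at h3
  rw [h2] at h3
  have := (mul_eq_zero.1 h3.symm).resolve_left (pow_ne_zero _ hA)
  simpa using this

theorem rowWedge_independent {R : Type*} [CommRing R] [IsDomain R] {k n : ℕ}
    (A : Matrix (Fin n) (Fin n) R) (hA : A.det ≠ 0) (c : (Fin k → Fin n) → R)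
    (h : ∑ I ∈ Finset.univ.filter (fun I : Fin k → Fin n => StrictMono I), c I • rowWedge A I = 0)
    (J : Fin k → Fin n) (hJ : StrictMono J) : c J = 0 := by
  have h1 := DFunLike.congr_fun h (A.adjugate.col ∘ J)
  rw [alternatingMap_sum_apply, Finset.sum_eq_single J] at h1
  · rw [AlternatingMap.smul_apply, rowWedge_adjugate A hJ hJ, if_pos rfl] at h1
    exact (mul_eq_zero.1 h1).resolve_right (pow_ne_zero _ hA)
  · intro I hI hIJ
    rw [AlternatingMap.smul_apply, rowWedge_adjugate A (Finset.mem_filter.1 hI).2 hJ, if_neg hIJ,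
      smul_zero]
  · intro hn
    exact absurd (Finset.mem_filter.2 ⟨Finset.mem_univ _, hJ⟩) hn

/-- Cramer's rule for alternating forms. -/
theorem det_pow_smul_eq_sum_rowWedge {R : Type*} [CommRing R] [IsDomain R] {k n : ℕ}
    (A : Matrix (Fin n) (Fin n) R) (hA : A.det ≠ 0) (F : (Fin n → R) [⋀^Fin k]→ₗ[R] R) :
    A.det ^ k • F = ∑ I ∈ Finset.univ.filter (fun I : Fin k → Fin n => StrictMono I),
      F (A.adjugate.col ∘ I) • rowWedge A I := by
  rw [← sub_eq_zero]
  refine alternating_eq_zero_of_adjugate A hA _ fun J hJ => ?_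
  rw [AlternatingMap.sub_apply, alternatingMap_sum_apply, Finset.sum_eq_single J]
  · rw [AlternatingMap.smul_apply, AlternatingMap.smul_apply, rowWedge_adjugate A hJ hJ,
      if_pos rfl, smul_eq_mul, smul_eq_mul, mul_comm, sub_self]
  · intro I hI hIJ
    rw [AlternatingMap.smul_apply, rowWedge_adjugate A (Finset.mem_filter.1 hI).2 hJ, if_neg hIJ,
      smul_zero]
  · intro hn
    exact absurd (Finset.mem_filter.2 ⟨Finset.mem_univ _, hJ⟩) hn

theorem dvd_det_of_dvd_col {R ι : Type*} [CommRing R] [Fintype ι] [DecidableEq ι]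
    (B : Matrix ι ι R) (l : R) (i : ι) (h : ∀ j, l ∣ B j i) : l ∣ B.det := by
  rw [← Ideal.mem_span_singleton, ← Ideal.Quotient.eq_zero_iff_mem, RingHom.map_det]
  refine Matrix.det_eq_zero_of_column_eq_zero i fun j => ?_
  exact Ideal.Quotient.eq_zero_iff_mem.2 (Ideal.mem_span_singleton.2 (h j))

theorem dvd_adjugate_of_dvd_col {R ι : Type*} [CommRing R] [Fintype ι] [DecidableEq ι]
    (B : Matrix ι ι R) (l : R) (i : ι) (h : ∀ j, l ∣ B j i) (t m : ι) (ht : t ≠ i) :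
    l ∣ B.adjugate t m := by
  rw [Matrix.adjugate_apply]
  refine dvd_det_of_dvd_col _ l i fun j => ?_
  rw [Matrix.updateRow_apply]
  split_ifs
  · simp [ht.symm]
  · exact h j

/-- If `l` divides a column of `A * E` and the values of `F` on tuples of columns of `E` which use
that column, then `l ^ k` divides the values of `F` on columns of the adjugate of `A`. -/
theorem pow_dvd_alternating_adjugate {R : Type*} [CommRing R] {k n : ℕ}
    (A E : Matrix (Fin n) (Fin n) R) (hE : E.det = 1) (l : R) (i : Fin n)
    (hcol : ∀ j, l ∣ (A * E) j i) (F : (Fin n → R) [⋀^Fin k]→ₗ[R] R)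
    (hF : ∀ (f : Fin k → Fin n) (b : Fin k), Function.Injective f → f b = i → l ∣ F (E.col ∘ f))
    (g : Fin k → Fin n) : l ^ k ∣ F (A.adjugate.col ∘ g) := by
  have hA : A.adjugate = E * (A * E).adjugate := by
    rw [Matrix.adjugate_mul_distrib, ← Matrix.mul_assoc, Matrix.mul_adjugate, hE, one_smul,
      Matrix.one_mul]
  have h1 : A.adjugate.col ∘ g = fun b => ∑ t, (A * E).adjugate t (g b) • E.col t := by
    funext b s
    simp only [Function.comp_apply, Matrix.col_apply, Finset.sum_apply, Pi.smul_apply, smul_eq_mul]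
    rw [hA, Matrix.mul_apply]
    exact Finset.sum_congr rfl fun _ _ => mul_comm _ _
  rw [h1]
  refine Dvd.dvd.trans (Finset.dvd_sum fun f _ => ?_)
    (dvd_of_eq (F.toMultilinearMap.map_sum _).symm)
  refine Dvd.dvd.trans ?_ (dvd_of_eq (F.toMultilinearMap.map_smul_univ
    (fun b => (A * E).adjugate (f b) (g b)) (fun b => E.col (f b))).symm)
  have hadj := dvd_adjugate_of_dvd_col (A * E) l i hcol
  by_cases hf : Function.Injective f
  · by_cases hb : ∃ b, f b = i
    · obtain ⟨b, hb⟩ := hb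
      have h2 : l ^ (k - 1) ∣ ∏ b' ∈ Finset.univ.erase b, (A * E).adjugate (f b') (g b') := by
        have := Finset.prod_dvd_prod_of_dvd (s := Finset.univ.erase b) (fun _ => l)
          (fun b' => (A * E).adjugate (f b') (g b')) fun b' hb' =>
            hadj _ _ fun h => (Finset.mem_erase.1 hb').1 (hf (h.trans hb.symm))
        simpa using this
      rw [← Finset.mul_prod_erase _ _ (Finset.mem_univ b), smul_eq_mul, mul_assoc]
      refine Dvd.dvd.mul_left ?_ _
      have hk : l ^ k = l ^ (k - 1) * l := by
        rw [← pow_succ, Nat.sub_add_cancel b.pos]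
      exact (dvd_of_eq hk).trans (mul_dvd_mul h2 (hF f b hf hb))
    · push Not at hb
      have := Finset.prod_dvd_prod_of_dvd (s := Finset.univ) (fun _ : Fin k => l)
          (fun b' => (A * E).adjugate (f b') (g b')) fun b' _ => hadj _ _ (hb b')
      exact (by simpa using this : l ^ k ∣ _).mul_right _
  · have : ¬ Function.Injective fun b => E.col (f b) := fun h =>
      hf (Function.Injective.of_comp (f := E.col) h)
    rw [AlternatingMap.coe_multilinearMap, F.map_eq_zero_of_not_injective _ this, smul_zero]
    exact dvd_zero _

/-- The standard basis vectors of `ℂⁿ`. -/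
def stdVec {n : ℕ} (i : Fin n) : EuclideanSpace ℂ (Fin n) := EuclideanSpace.single i 1

theorem stdVec_apply {n : ℕ} (i j : Fin n) : stdVec i j = if j = i then 1 else 0 := by
  simp [stdVec]

/-- Vectors of `ℂⁿ` as vectors of constant polynomials. -/
def constVec {n : ℕ} : EuclideanSpace ℂ (Fin n) →ₗ[ℂ] (Fin n → MvPolynomial (Fin n) ℂ) where
  toFun w i := C (w i)
  map_add' u v := by ext1 i; simp
  map_smul' a u := by ext1 i; simp [smul_eq_C_mul]

/-- The alternating form on `ℂⁿ` given by restricting one which is linear over polynomials. -/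
def restrictForm {n k : ℕ}
    (F : (Fin n → MvPolynomial (Fin n) ℂ) [⋀^Fin k]→ₗ[MvPolynomial (Fin n) ℂ]
      MvPolynomial (Fin n) ℂ) :
    (EuclideanSpace ℂ (Fin n)) [⋀^Fin k]→ₗ[ℂ] MvPolynomial (Fin n) ℂ :=
  AlternatingMap.compLinearMap
    { toMultilinearMap := F.toMultilinearMap.restrictScalars ℂ
      map_eq_zero_of_eq' := fun v _ _ hv hij => F.map_eq_zero_of_eq v hv hij }
    constVec

theorem restrictForm_apply {n k : ℕ}
    (F : (Fin n → MvPolynomial (Fin n) ℂ) [⋀^Fin k]→ₗ[MvPolynomial (Fin n) ℂ]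
      MvPolynomial (Fin n) ℂ) (w : Fin k → EuclideanSpace ℂ (Fin n)) :
    restrictForm F w = F fun a => constVec (w a) := rfl

theorem constVec_stdVec {n : ℕ} (i : Fin n) :
    constVec (stdVec i) = Pi.basisFun (MvPolynomial (Fin n) ℂ) (Fin n) i := by
  ext1 j
  change C (stdVec i j) = _
  rw [stdVec_apply]
  split_ifs with h <;> simp [h]

theorem eq_zero_of_restrictForm_eq_zero {n k : ℕ}
    (F : (Fin n → MvPolynomial (Fin n) ℂ) [⋀^Fin k]→ₗ[MvPolynomial (Fin n) ℂ]
      MvPolynomial (Fin n) ℂ) (h : ∀ w, restrictForm F w = 0) : F = 0 := by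
  refine Module.Basis.ext_alternating (Pi.basisFun _ (Fin n)) fun v _ => ?_
  have := h fun a => stdVec (v a)
  rw [restrictForm_apply] at this
  simp only [constVec_stdVec] at this
  simpa using this

theorem exists_restrictForm_eq {n k : ℕ}
    (s : (EuclideanSpace ℂ (Fin n)) [⋀^Fin k]→ₗ[ℂ] MvPolynomial (Fin n) ℂ) :
    ∃ F, restrictForm F = s := by
  refine ⟨∑ I ∈ Finset.univ.filter (fun I : Fin k → Fin n => StrictMono I),
    s (stdVec ∘ I) • rowWedge 1 I, ?_⟩
  refine Module.Basis.ext_alternating (EuclideanSpace.basisFun (Fin n) ℂ).toBasis fun v _ => ?_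
  have hb : (fun i => (EuclideanSpace.basisFun (Fin n) ℂ).toBasis (v i)) = stdVec ∘ v := by
    funext i; simp [stdVec]
  rw [hb]
  refine alternating_eq_of_strictMono _ _ _ (fun J hJ => ?_) v
  have hc : (fun a => constVec ((stdVec ∘ J) a)) =
      (1 : Matrix (Fin n) (Fin n) (MvPolynomial (Fin n) ℂ)).adjugate.col ∘ J := by
    funext a
    ext1 t
    simp [constVec_stdVec, Matrix.one_apply, Pi.single_apply]
  rw [restrictForm_apply, alternatingMap_sum_apply, hc, Finset.sum_eq_single J]
  · rw [AlternatingMap.smul_apply, rowWedge_adjugate _ hJ hJ]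
    simp
  · intro I hI hIJ
    rw [AlternatingMap.smul_apply, rowWedge_adjugate _ (Finset.mem_filter.1 hI).2 hJ, if_neg hIJ,
      smul_zero]
  · intro hn
    exact absurd (Finset.mem_filter.2 ⟨Finset.mem_univ _, hJ⟩) hn

/-- The coefficient matrix of the basic derivations. -/
def thetaMatrix (r p n : ℕ) : Matrix (Fin n) (Fin n) (MvPolynomial (Fin n) ℂ) :=
  Matrix.of fun a i => theta r p n a (stdVec i)

theorem oneForm_stdVec {n : ℕ} (c : Fin n → MvPolynomial (Fin n) ℂ) (i : Fin n) :
    oneForm c (stdVec i) = c i := by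
  change ∑ j, stdVec i j • c j = c i
  simp [stdVec_apply]

theorem thetaMatrix_mulVec (r p n : ℕ) (w : EuclideanSpace ℂ (Fin n)) (j : Fin n) :
    (thetaMatrix r p n).mulVec (constVec w) j = theta r p n j w := by
  have key : ∀ c : Fin n → MvPolynomial (Fin n) ℂ,
      ∑ i, oneForm c (stdVec i) * constVec w i = oneForm c w := by
    intro c
    simp only [oneForm_stdVec]
    change ∑ i, c i * C (w i) = ∑ i, w i • c i
    exact Finset.sum_congr rfl fun i _ => by rw [smul_eq_C_mul, mul_comm]
  change ∑ i, theta r p n j (stdVec i) * constVec w i = _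
  unfold theta
  split_ifs <;> exact key _

theorem wedge_theta_eq {r p n k : ℕ} (I : Fin k → Fin n) :
    wedge k (fun b => theta r p n (I b)) = restrictForm (rowWedge (thetaMatrix r p n) I) := by
  ext1 w
  rw [restrictForm_apply, rowWedge_apply]
  simp only [thetaMatrix_mulVec]
  rfl

theorem restrictForm_sum_smul {n k : ℕ} {κ : Type*} (s : Finset κ)
    (c : κ → MvPolynomial (Fin n) ℂ)
    (F : κ → (Fin n → MvPolynomial (Fin n) ℂ) [⋀^Fin k]→ₗ[MvPolynomial (Fin n) ℂ]
      MvPolynomial (Fin n) ℂ) :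
    restrictForm (∑ i ∈ s, c i • F i) = ∑ i ∈ s, c i • restrictForm (F i) := by
  ext1 w
  rw [restrictForm_apply, alternatingMap_sum_apply, alternatingMap_sum_apply]
  rfl

theorem act_X_of_monomial {n : ℕ} {M : Matrix (Fin n) (Fin n) ℂ} {σ : Equiv.Perm (Fin n)}
    {d : Fin n → ℂ} (hM : ∀ i j, M i j = if i = σ j then d j else 0) (j : Fin n) :
    act M (X j) = C (d j) * X (σ j) := by
  rw [act, aeval_X, Finset.sum_eq_single (σ j)]
  · simp [hM]
  · intro i _ hi
    simp [hM, hi]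
  · simp

theorem toEuclideanLin_apply_of_monomial {n : ℕ} {M : Matrix (Fin n) (Fin n) ℂ}
    {σ : Equiv.Perm (Fin n)} {d : Fin n → ℂ} (hM : ∀ i j, M i j = if i = σ j then d j else 0)
    (w : EuclideanSpace ℂ (Fin n)) (j : Fin n) :
    Matrix.toEuclideanLin M w (σ j) = d j * w j := by
  change ∑ t, M (σ j) t * w t = _
  rw [Finset.sum_eq_single j]
  · simp [hM]
  · intro t _ ht
    simp [hM, ht.symm]
  · simp

theorem prod_sum_of_monomial {n : ℕ} {M : Matrix (Fin n) (Fin n) ℂ}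
    {σ : Equiv.Perm (Fin n)} {d : Fin n → ℂ} (hM : ∀ i j, M i j = if i = σ j then d j else 0) :
    ∏ i, ∑ j, M i j = ∏ j, d j := by
  rw [← Equiv.prod_comp σ]
  refine Finset.prod_congr rfl fun j _ => ?_
  rw [Finset.sum_eq_single j]
  · simp [hM]
  · intro t _ ht
    simp [hM, ht.symm]
  · simp

theorem act_oneForm {n : ℕ} {M : Matrix (Fin n) (Fin n) ℂ} {σ : Equiv.Perm (Fin n)}
    {d : Fin n → ℂ} (hM : ∀ i j, M i j = if i = σ j then d j else 0)
    (c : Fin n → MvPolynomial (Fin n) ℂ) (hc : ∀ j, act M (c j) = C (d j) * c (σ j))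
    (w : EuclideanSpace ℂ (Fin n)) :
    act M (oneForm c w) = oneForm c (Matrix.toEuclideanLin M w) := by
  change act M (∑ i, w i • c i) = ∑ i, (Matrix.toEuclideanLin M w) i • c i
  rw [map_sum, ← Equiv.sum_comp σ fun i => (Matrix.toEuclideanLin M w) i • c i]
  refine Finset.sum_congr rfl fun j _ => ?_
  rw [toEuclideanLin_apply_of_monomial hM, map_smul, hc, smul_eq_C_mul, smul_eq_C_mul, C_mul]
  ring

theorem act_theta {r p n : ℕ} (hr : 0 < r) {M : Matrix (Fin n) (Fin n) ℂ} (hM : M ∈ GG r p n)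
    (a : Fin n) (w : EuclideanSpace ℂ (Fin n)) :
    act M (theta r p n a w) = theta r p n a (Matrix.toEuclideanLin M w) := by
  obtain ⟨⟨σ, d, hd, hM⟩, hprod⟩ := hM
  rw [prod_sum_of_monomial hM] at hprod
  unfold theta
  split_ifs with h
  · refine act_oneForm hM _ (fun j => ?_) w
    obtain ⟨-, rfl⟩ := h
    rw [Nat.div_self hr, pow_one, ← Finset.mul_prod_erase _ _ (Finset.mem_univ j)] at hprod
    have hy : (∏ t ∈ Finset.univ.erase j, d t) ^ p = 1 := by
      rw [← Finset.prod_pow]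
      exact Finset.prod_eq_one fun t _ => hd t
    have hy' : (∏ t ∈ Finset.univ.erase j, d t) ^ (p - 1) = d j := by
      set y := ∏ t ∈ Finset.univ.erase j, d t
      calc y ^ (p - 1) = y ^ (p - 1) * (d j * y) := by rw [hprod, mul_one]
        _ = d j * y ^ (p - 1 + 1) := by rw [pow_succ]; ring
        _ = d j := by rw [Nat.sub_add_cancel hr, hy, mul_one]
    have himg : Finset.univ.erase (σ j) = (Finset.univ.erase j).map σ.toEmbedding := by
      ext t; simp
    rw [map_prod, himg, Finset.prod_map, ← hy', ← Finset.prod_pow, map_prod, ← Finset.prod_mul_distrib]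
    refine Finset.prod_congr rfl fun t _ => ?_
    rw [map_pow, act_X_of_monomial hM, mul_pow, C_pow]
    rfl
  · refine act_oneForm hM _ (fun j => ?_) w
    rw [map_pow, act_X_of_monomial hM, mul_pow, ← C_pow]
    congr 2
    rw [pow_succ, mul_comm (a : ℕ) r, pow_mul, hd, one_pow, one_mul]

theorem act_wedge_theta {r p n k : ℕ} (hr : 0 < r) {M : Matrix (Fin n) (Fin n) ℂ}
    (hM : M ∈ GG r p n) (I : Fin k → Fin n) (w : Fin k → EuclideanSpace ℂ (Fin n)) :
    act M (wedge k (fun b => theta r p n (I b)) w) =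
      wedge k (fun b => theta r p n (I b)) fun i => Matrix.toEuclideanLin M (w i) := by
  change act M (Matrix.det (Matrix.of fun a b => theta r p n (I b) (w a))) =
    Matrix.det (Matrix.of fun a b => theta r p n (I b) (Matrix.toEuclideanLin M (w a)))
  rw [AlgHom.map_det]
  congr 1
  ext1 a b
  exact act_theta hr hM _ _

theorem toEuclideanLin_surjective_of_mem {r p n : ℕ} (hr : 0 < r) {M : Matrix (Fin n) (Fin n) ℂ}
    (hM : M ∈ GG r p n) : Function.Surjective (Matrix.toEuclideanLin M) := by
  obtain ⟨⟨σ, d, hd, hM⟩, -⟩ := hM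
  intro v
  refine ⟨WithLp.toLp 2 fun j => (d j)⁻¹ * v (σ j), ?_⟩
  ext i
  obtain ⟨j, rfl⟩ := σ.surjective i
  have hdj : d j ≠ 0 := fun h => by simpa [h, hr.ne'] using hd j
  rw [toEuclideanLin_apply_of_monomial hM]
  change d j * ((d j)⁻¹ * v (σ j)) = _
  rw [mul_inv_cancel_left₀ hdj]

/-- If `M` acts trivially modulo `l`, then `l` divides each nontrivial eigenvector of `M`. -/
theorem dvd_of_act_eq_smul {n : ℕ} {M : Matrix (Fin n) (Fin n) ℂ} {l q : MvPolynomial (Fin n) ℂ}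
    {z : ℂ} (hl : ∀ j, l ∣ act M (X j) - X j) (hz : z ≠ 1) (hq : act M q = C z * q) : l ∣ q := by
  have h1 : (Ideal.Quotient.mkₐ ℂ (Ideal.span {l})).comp (act M) =
      Ideal.Quotient.mkₐ ℂ (Ideal.span {l}) := by
    refine MvPolynomial.algHom_ext fun j => ?_
    exact (Ideal.Quotient.eq).2 (Ideal.mem_span_singleton.2 (hl j))
  have h2 : l ∣ act M q - q :=
    Ideal.mem_span_singleton.1 ((Ideal.Quotient.eq).1 (DFunLike.congr_fun h1 q))
  have h3 : q = C (z - 1)⁻¹ * (act M q - q) := by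
    rw [hq, ← sub_one_mul, ← C_1, ← C_sub, ← mul_assoc, ← C_mul,
      inv_mul_cancel₀ (sub_ne_zero.2 hz), C_1, one_mul]
  rw [h3]
  exact h2.mul_left _

/-- The columns of a complex matrix. -/
def colVec {n : ℕ} (P : Matrix (Fin n) (Fin n) ℂ) (t : Fin n) : EuclideanSpace ℂ (Fin n) :=
  WithLp.toLp 2 (P.col t)

theorem toEuclideanLin_colVec {n : ℕ} {M P : Matrix (Fin n) (Fin n) ℂ} {e : Fin n → ℂ}
    (h : M * P = P * Matrix.diagonal e) (t : Fin n) :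
    Matrix.toEuclideanLin M (colVec P t) = e t • colVec P t := by
  ext s
  have := congrFun (congrFun h s) t
  rw [Matrix.mul_diagonal, mul_comm] at this
  exact this

/-- Divisibility of the coefficients of invariant forms at a reflection `M` which is diagonalized
by `P` with nontrivial eigenvalue `z`. -/
theorem pow_dvd_of_reflection {r p n k : ℕ} (hr : 0 < r) {M P : Matrix (Fin n) (Fin n) ℂ}
    (hM : M ∈ GG r p n) (i : Fin n) {z : ℂ} (hz : z ≠ 1)
    (hMP : M * P = P * Matrix.diagonal fun t => if t = i then z else 1) (hP : P.det = 1)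
    {l : MvPolynomial (Fin n) ℂ} (hl : ∀ j, l ∣ act M (X j) - X j)
    (F : (Fin n → MvPolynomial (Fin n) ℂ) [⋀^Fin k]→ₗ[MvPolynomial (Fin n) ℂ]
      MvPolynomial (Fin n) ℂ)
    (hF : ∀ w, act M (restrictForm F w) = restrictForm F fun i => Matrix.toEuclideanLin M (w i))
    (g : Fin k → Fin n) : l ^ k ∣ F ((thetaMatrix r p n).adjugate.col ∘ g) := by
  refine pow_dvd_alternating_adjugate _ (P.map C) ?_ l i ?_ F ?_ g
  · have := (RingHom.map_det (C : ℂ →+* MvPolynomial (Fin n) ℂ) P).symm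
    rw [hP, C_1] at this
    exact this
  · intro j
    have h1 : (thetaMatrix r p n * (P.map C : Matrix (Fin n) (Fin n) (MvPolynomial (Fin n) ℂ))) j i = theta r p n j (colVec P i) :=
      thetaMatrix_mulVec r p n (colVec P i) j
    rw [h1]
    refine dvd_of_act_eq_smul hl hz ?_
    rw [act_theta hr hM, toEuclideanLin_colVec hMP, map_smul, if_pos rfl, smul_eq_C_mul]
  · intro f b hf hb
    have h1 : F ((P.map C).col ∘ f) = restrictForm F fun a => colVec P (f a) := rfl
    rw [h1]
    refine dvd_of_act_eq_smul hl hz ?_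
    rw [hF]
    simp only [toEuclideanLin_colVec hMP]
    refine ((restrictForm F).toMultilinearMap.map_smul_univ _ _).trans ?_
    rw [smul_eq_C_mul]
    congr 2
    have : ∀ a, f a = i ↔ a = b := fun a => by rw [← hb, hf.eq_iff]
    simp [this]

/-- The linear form of the mirror `v_j = z v_i`. -/
def mirrorForm {n : ℕ} (x : (Fin n × Fin n) × ℂ) : MvPolynomial (Fin n) ℂ :=
  X x.1.2 - C x.2 * X x.1.1

theorem prime_mirrorForm {n : ℕ} {i j : Fin n} (hij : i ≠ j) (z : ℂ) :
    Prime (mirrorForm ((i, j), z)) := by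
  let f (z : ℂ) : MvPolynomial (Fin n) ℂ →ₐ[ℂ] MvPolynomial (Fin n) ℂ :=
    aeval fun t => if t = j then X j - C z * X i else X t
  have hi : ∀ z, f z (X i) = X i := fun z => by simp [f, hij]
  have hj : ∀ z, f z (X j) = X j - C z * X i := fun z => by simp [f]
  have ht : ∀ z t, t ≠ j → f z (X t) = X t := fun z t h => by simp [f, h]
  have hC : ∀ z y, f z (C y) = C y := fun z y => (f z).commutes y
  have key : ∀ z y, z + y = 0 → (f z).comp (f y) = AlgHom.id ℂ _ := fun z y h => by
    refine MvPolynomial.algHom_ext fun t => ?_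
    by_cases htj : t = j
    · subst htj
      have : C z + C y = (0 : MvPolynomial (Fin n) ℂ) := by rw [← C_add, h, C_0]
      rw [AlgHom.comp_apply, hj, map_sub, map_mul, hC, hi, hj, AlgHom.id_apply]
      linear_combination -X i * this
    · rw [AlgHom.comp_apply, ht _ _ htj, ht _ _ htj, AlgHom.id_apply]
  let e := AlgEquiv.ofAlgHom (f z) (f (-z)) (key _ _ (by ring)) (key _ _ (by ring))
  have he : mirrorForm ((i, j), z) = e (X j) := (hj z).symm
  rw [he, MulEquiv.prime_iff]
  exact MvPolynomial.X_prime

theorem isRelPrime_of_eval {n : ℕ} {f g : MvPolynomial (Fin n) ℂ} (hf : Prime f)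
    (v : Fin n → ℂ) (h0 : eval v f = 0) (h1 : eval v g ≠ 0) : IsRelPrime f g := by
  refine hf.irreducible.isRelPrime_iff_not_dvd.2 fun h => h1 ?_
  obtain ⟨q, rfl⟩ := h
  rw [map_mul, h0, zero_mul]

theorem eval_mirrorForm {n : ℕ} (v : Fin n → ℂ) (i j : Fin n) (z : ℂ) :
    eval v (mirrorForm ((i, j), z)) = v j - z * v i := by
  simp [mirrorForm]

theorem isRelPrime_X {n : ℕ} {i j : Fin n} (h : i ≠ j) :
    IsRelPrime (X i : MvPolynomial (Fin n) ℂ) (X j) :=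
  isRelPrime_of_eval MvPolynomial.X_prime (Pi.single j 1) (by simp [h]) (by simp)

theorem isRelPrime_X_mirrorForm {n : ℕ} (t : Fin n) {i j : Fin n} (hij : i ≠ j) {z : ℂ}
    (hz : z ≠ 0) : IsRelPrime (X t) (mirrorForm ((i, j), z)) := by
  by_cases htj : t = j
  · refine isRelPrime_of_eval MvPolynomial.X_prime (Pi.single i 1) ?_ ?_
    · simp [htj, hij.symm]
    · simp [eval_mirrorForm, hij.symm, hz]
  · refine isRelPrime_of_eval MvPolynomial.X_prime (Pi.single j 1) ?_ ?_
    · simp [htj]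
    · simp [eval_mirrorForm, hij]

theorem isRelPrime_mirrorForm {n : ℕ} {i j i' j' : Fin n} (hij : i < j) (hij' : i' < j') {z z' : ℂ}
    (hz' : z' ≠ 0) (h : ((i, j), z) ≠ ((i', j'), z')) :
    IsRelPrime (mirrorForm ((i, j), z)) (mirrorForm ((i', j'), z')) := by
  have hp := prime_mirrorForm hij.ne z
  by_cases hj : j' = i ∨ j' = j
  · by_cases hi : i' = i ∨ i' = j
    · have hii : i' = i := by grind
      have hjj : j' = j := by grind
      subst hii hjj
      have hzz : z ≠ z' := fun h' => h (by rw [h'])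
      refine isRelPrime_of_eval hp (fun t => if t = j' then z else 1) ?_ ?_
      · simp [eval_mirrorForm, hij.ne]
      · simpa [eval_mirrorForm, hij.ne, sub_eq_zero] using hzz
    · push Not at hi
      refine isRelPrime_of_eval hp (Pi.single i' 1) ?_ ?_
      · simp [eval_mirrorForm, hi.1.symm, hi.2.symm]
      · simp [eval_mirrorForm, hij'.ne', hz']
  · push Not at hj
    refine isRelPrime_of_eval hp (Pi.single j' 1) ?_ ?_
    · simp [eval_mirrorForm, hj.1.symm, hj.2.symm]
    · simp [eval_mirrorForm, hij'.ne]

/-- Indices of the mirrors `v_j = z v_i`, with `i < j` and `z` an `r`-th root of unity. -/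
def mirrors (r n : ℕ) : Finset ((Fin n × Fin n) × ℂ) :=
  (Finset.univ.filter fun q : Fin n × Fin n => q.1 < q.2) ×ˢ Polynomial.nthRootsFinset r (1 : ℂ)

theorem X_pow_sub_X_pow_eq_prod {r n : ℕ} (hr : 0 < r) {ξ : ℂ} (hξ : IsPrimitiveRoot ξ r)
    (i j : Fin n) : (X j ^ r - X i ^ r : MvPolynomial (Fin n) ℂ) =
      ∏ z ∈ Polynomial.nthRootsFinset r (1 : ℂ), mirrorForm ((i, j), z) := by
  have hinj : Function.Injective (C : ℂ →+* MvPolynomial (Fin n) ℂ) := C_injective _ _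
  have hξ' : IsPrimitiveRoot (C ξ : MvPolynomial (Fin n) ℂ) r := hξ.map_of_injective hinj
  have himg : (Polynomial.nthRootsFinset r (1 : ℂ)).image C =
      Polynomial.nthRootsFinset r (1 : MvPolynomial (Fin n) ℂ) := by
    refine Finset.eq_of_subset_of_card_le (fun y hy => ?_) ?_
    · obtain ⟨z, hz, rfl⟩ := Finset.mem_image.1 hy
      rw [Polynomial.mem_nthRootsFinset hr] at hz ⊢
      rw [← C_pow, hz, C_1]
    · rw [Finset.card_image_of_injective _ hinj, hξ.card_nthRootsFinset, hξ'.card_nthRootsFinset]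
  rw [hξ'.pow_sub_pow_eq_prod_sub_mul _ _ hr, ← himg, Finset.prod_image fun _ _ _ _ h => hinj h]
  rfl

theorem det_vandermonde_X_pow {r n : ℕ} (hr : 0 < r) {ξ : ℂ} (hξ : IsPrimitiveRoot ξ r) :
    (Matrix.vandermonde fun i : Fin n => (X i ^ r : MvPolynomial (Fin n) ℂ)).det =
      ∏ x ∈ mirrors r n, mirrorForm x := by
  rw [Matrix.det_vandermonde, mirrors, Finset.prod_product, Finset.prod_filter,
    Fintype.prod_prod_type]
  refine Finset.prod_congr rfl fun i _ => ?_
  rw [← Finset.prod_filter]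
  refine Finset.prod_congr (by ext; simp) fun j _ => X_pow_sub_X_pow_eq_prod hr hξ i j

theorem theta_stdVec (r p n : ℕ) (a i : Fin n) :
    thetaMatrix r p n a i = if (a : ℕ) = n - 1 ∧ p = r then
      ∏ t ∈ Finset.univ.erase i, X t ^ (r - 1) else X i ^ ((a : ℕ) * r + 1) := by
  change theta r p n a (stdVec i) = _
  unfold theta
  split_ifs <;> rw [oneForm_stdVec]

theorem det_thetaMatrix_of_ne {r p n : ℕ} (hpr : p ≠ r) :
    (thetaMatrix r p n).det = (∏ i, X i) *
      (Matrix.vandermonde fun i : Fin n => (X i ^ r : MvPolynomial (Fin n) ℂ)).det := by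
  rw [← Matrix.det_transpose (Matrix.vandermonde _), ← Matrix.det_mul_row]
  congr 1
  ext1 a i
  rw [theta_stdVec, if_neg fun h => hpr h.2, Matrix.of_apply, Matrix.transpose_apply,
    Matrix.vandermonde_apply, ← pow_mul, pow_succ', mul_comm r]

theorem det_thetaMatrix_self {r m : ℕ} (hr : 0 < r) :
    (thetaMatrix r r (m + 1)).det = ((Equiv.Perm.sign (finRotate (m + 1)) : ℤ) :
        MvPolynomial (Fin (m + 1)) ℂ) *
      (Matrix.vandermonde fun i : Fin (m + 1) =>
        (X i ^ r : MvPolynomial (Fin (m + 1)) ℂ)).det := by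
  have hE : ∏ i : Fin (m + 1), (X i ^ (r - 1) : MvPolynomial (Fin (m + 1)) ℂ) ≠ 0 :=
    Finset.prod_ne_zero_iff.2 fun i _ => pow_ne_zero _ (X_ne_zero i)
  refine mul_left_cancel₀ hE ?_
  rw [← Matrix.det_transpose (Matrix.vandermonde _), ← Matrix.det_permute, ← Matrix.det_mul_row]
  have hv : ∏ i : Fin (m + 1), (X i ^ (r - 1) : MvPolynomial (Fin (m + 1)) ℂ) =
      ∏ a : Fin (m + 1), if a = Fin.last m then
        ∏ i : Fin (m + 1), (X i ^ (r - 1) : MvPolynomial (Fin (m + 1)) ℂ) else 1 := by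
    rw [Finset.prod_ite_eq' Finset.univ (Fin.last m), if_pos (Finset.mem_univ _)]
  rw [hv, ← Matrix.det_mul_column]
  congr 1
  ext1 a i
  rw [Matrix.of_apply, Matrix.of_apply, theta_stdVec, Matrix.submatrix_apply,
    Matrix.transpose_apply, Matrix.vandermonde_apply, id]
  by_cases ha : a = Fin.last m
  · subst ha
    rw [if_pos (by simp), if_pos rfl,
      Finset.mul_prod_erase Finset.univ (fun t => X t ^ (r - 1)) (Finset.mem_univ i),
      finRotate_last]
    simp
  · have hlt : (a : ℕ) < m := Fin.val_lt_last ha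
    have hrot : (finRotate (m + 1) a : ℕ) = a + 1 := by
      rw [coe_finRotate_of_ne_last ha]
    rw [if_neg fun h => hlt.ne h.1, if_neg ha, hrot, one_mul, ← pow_add, ← pow_mul]
    congr 1
    have : r - 1 + 1 = r := Nat.sub_add_cancel hr
    calc r - 1 + (a * r + 1) = (r - 1 + 1) + a * r := by ring
      _ = r * (a + 1) := by rw [this]; ring

theorem det_thetaMatrix {r p n : ℕ} (hr : 0 < r) (hn : 0 < n) {ξ : ℂ}
    (hξ : IsPrimitiveRoot ξ r) : ∃ ε : MvPolynomial (Fin n) ℂ, IsUnit ε ∧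
      (thetaMatrix r p n).det =
        ε * ((if p = r then 1 else ∏ i, X i) * ∏ x ∈ mirrors r n, mirrorForm x) := by
  split_ifs with h
  · subst h
    obtain ⟨m, rfl⟩ : ∃ m, n = m + 1 := ⟨n - 1, by omega⟩
    refine ⟨((Equiv.Perm.sign (finRotate (m + 1)) : ℤ) : MvPolynomial (Fin (m + 1)) ℂ), ?_, ?_⟩
    · exact (Equiv.Perm.sign (finRotate (m + 1))).isUnit.map
        (Int.castRingHom (MvPolynomial (Fin (m + 1)) ℂ))
    · rw [det_thetaMatrix_self hr, det_vandermonde_X_pow hr hξ, one_mul]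
  · exact ⟨1, isUnit_one, by rw [det_thetaMatrix_of_ne h, det_vandermonde_X_pow hr hξ, one_mul]⟩

theorem mem_mirrors {r n : ℕ} (hr : 0 < r) {x : (Fin n × Fin n) × ℂ} (hx : x ∈ mirrors r n) :
    x.1.1 < x.1.2 ∧ x.2 ^ r = 1 ∧ x.2 ≠ 0 := by
  obtain ⟨h1, h2⟩ := Finset.mem_product.1 hx
  rw [Polynomial.mem_nthRootsFinset hr] at h2
  exact ⟨(Finset.mem_filter.1 h1).2, h2, fun h => by simp [h, hr.ne'] at h2⟩

theorem det_thetaMatrix_ne_zero {r p n : ℕ} (hr : 0 < r) (hn : 0 < n) {ξ : ℂ}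
    (hξ : IsPrimitiveRoot ξ r) : (thetaMatrix r p n).det ≠ 0 := by
  obtain ⟨ε, hε, h⟩ := det_thetaMatrix (p := p) hr hn hξ
  rw [h]
  refine mul_ne_zero hε.ne_zero (mul_ne_zero ?_ ?_)
  · split_ifs
    · exact one_ne_zero
    · exact Finset.prod_ne_zero_iff.2 fun i _ => X_ne_zero i
  · exact Finset.prod_ne_zero_iff.2 fun x hx => (prime_mirrorForm (mem_mirrors hr hx).1.ne x.2).ne_zero

/-- Forms invariant under `G(r,p,n)`. -/
def IsInvariantForm {k : ℕ} (r p n : ℕ)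
    (s : (EuclideanSpace ℂ (Fin n)) [⋀^Fin k]→ₗ[ℂ] MvPolynomial (Fin n) ℂ) : Prop :=
  ∀ M ∈ GG r p n, ∀ w, act M (s w) = s fun i => Matrix.toEuclideanLin M (w i)

theorem X_pow_dvd_of_isInvariantForm {r p n k : ℕ} (hr : 0 < r) (hp : 0 < p) (hpr : p ∣ r)
    (hne : p ≠ r) {ξ : ℂ} (hξ : IsPrimitiveRoot ξ r)
    (F : (Fin n → MvPolynomial (Fin n) ℂ) [⋀^Fin k]→ₗ[MvPolynomial (Fin n) ℂ]
      MvPolynomial (Fin n) ℂ) (hF : IsInvariantForm r p n (restrictForm F))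
    (i : Fin n) (g : Fin k → Fin n) : X i ^ k ∣ F ((thetaMatrix r p n).adjugate.col ∘ g) := by
  have hlt : p < r := lt_of_le_of_ne (Nat.le_of_dvd hr hpr) hne
  have hz : ξ ^ p ≠ 1 := hξ.pow_ne_one_of_pos_of_lt hp.ne' hlt
  set d : Fin n → ℂ := fun t => if t = i then ξ ^ p else 1 with hd
  have hmono : ∀ a b, Matrix.diagonal d a b = if a = (1 : Equiv.Perm (Fin n)) b then d b else 0 := by
    intro a b
    rw [Matrix.diagonal_apply]
    split_ifs with h1 h2 h2
    · rw [h1]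
    · exact absurd h1 h2
    · exact absurd h2 h1
    · rfl
  have hM : Matrix.diagonal d ∈ GG r p n := by
    refine ⟨⟨1, d, fun j => ?_, hmono⟩, ?_⟩
    · rw [hd]
      dsimp only
      split_ifs
      · rw [← pow_mul, mul_comm, pow_mul, hξ.pow_eq_one, one_pow]
      · exact one_pow _
    · rw [prod_sum_of_monomial hmono, hd, Finset.prod_ite_eq' Finset.univ i,
        if_pos (Finset.mem_univ _), ← pow_mul, Nat.mul_div_cancel' hpr, hξ.pow_eq_one]
  refine pow_dvd_of_reflection hr hM (P := 1) i hz ?_ Matrix.det_one ?_ F (hF _ hM) g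
  · rw [Matrix.mul_one, Matrix.one_mul]
  · intro j
    rw [act_X_of_monomial hmono, Equiv.Perm.one_apply]
    by_cases h : j = i
    · subst h
      exact dvd_sub (dvd_mul_left _ _) dvd_rfl
    · simp [hd, h]

theorem mirrorForm_pow_dvd_of_isInvariantForm {r p n k : ℕ} (hr : 0 < r)
    (F : (Fin n → MvPolynomial (Fin n) ℂ) [⋀^Fin k]→ₗ[MvPolynomial (Fin n) ℂ]
      MvPolynomial (Fin n) ℂ) (hF : IsInvariantForm r p n (restrictForm F))
    {i j : Fin n} (hij : i ≠ j) {z : ℂ} (hz : z ^ r = 1) (g : Fin k → Fin n) :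
    mirrorForm ((i, j), z) ^ k ∣ F ((thetaMatrix r p n).adjugate.col ∘ g) := by
  have hz0 : z ≠ 0 := fun h => by simp [h, hr.ne'] at hz
  set d : Fin n → ℂ := fun t => if t = j then z else if t = i then z⁻¹ else 1 with hd
  have hdi : d i = z⁻¹ := by simp [hd, hij]
  have hdj : d j = z := by simp [hd]
  have hdt : ∀ t, t ≠ i → t ≠ j → d t = 1 := fun t h1 h2 => by simp [hd, h1, h2]
  set M : Matrix (Fin n) (Fin n) ℂ :=
    Matrix.of fun a b => if a = Equiv.swap i j b then d b else 0
  have hmono : ∀ a b, M a b = if a = Equiv.swap i j b then d b else 0 := fun a b => rfl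
  have hM : M ∈ GG r p n := by
    refine ⟨⟨Equiv.swap i j, d, fun t => ?_, hmono⟩, ?_⟩
    · rw [hd]
      dsimp only
      split_ifs
      · exact hz
      · rw [inv_pow, hz, inv_one]
      · exact one_pow _
    · rw [prod_sum_of_monomial hmono, ← Finset.mul_prod_erase _ _ (Finset.mem_univ i),
        ← Finset.mul_prod_erase _ _ (Finset.mem_erase.2 ⟨hij.symm, Finset.mem_univ j⟩),
        Finset.prod_eq_one, mul_one, hdi, hdj, inv_mul_cancel₀ hz0, one_pow]
      intro t ht
      simp only [Finset.mem_erase, Finset.mem_univ, and_true] at ht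
      exact hdt t ht.2 ht.1
  refine pow_dvd_of_reflection hr hM
    (P := Matrix.transvection i j (-z) * Matrix.transvection j i (2 * z)⁻¹) j
    (z := -1) (by norm_num) ?_ ?_ ?_ F (hF _ hM) g
  · ext a b
    rw [← Matrix.mul_assoc, Matrix.mul_diagonal]
    have hT : ∀ a b, Matrix.transvection i j (-z) a b =
        (if a = b then 1 else 0) + if i = a ∧ j = b then -z else 0 := fun a b => by
      simp [Matrix.transvection, Matrix.one_apply, Matrix.single_apply]
    by_cases hbi : b = i
    · subst hbi
      rw [Matrix.mul_transvection_apply_same, Matrix.mul_transvection_apply_same,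
        Matrix.mul_transvection_apply_same, Matrix.mul_transvection_apply_of_ne _ _ _ _ hij,
        hmono, hmono, hT, hT, hdi, hdj, Equiv.swap_apply_left, Equiv.swap_apply_right, if_neg hij]
      by_cases h1 : a = b
      · subst h1
        simp [hij, hij.symm]
        field_simp
        norm_num
      · by_cases h2 : a = j
        · subst h2
          simp [hij, hij.symm]
          rw [mul_inv_cancel₀ hz0]
          ring
        · simp [h1, h2, Ne.symm h1]
    · by_cases hbj : b = j
      · subst hbj
        rw [Matrix.mul_transvection_apply_of_ne _ _ _ _ hij.symm,
          Matrix.mul_transvection_apply_same, Matrix.mul_transvection_apply_of_ne _ _ _ _ hij.symm,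
          hmono, hmono, hT, hdi, hdj, Equiv.swap_apply_left, Equiv.swap_apply_right, if_pos rfl]
        by_cases h1 : a = i
        · subst h1
          simp [hij]
        · by_cases h2 : a = b
          · subst h2
            simp [hij, hij.symm, hz0]
          · simp [h1, h2, Ne.symm h1]
      · rw [Matrix.mul_transvection_apply_of_ne _ _ _ _ hbi,
          Matrix.mul_transvection_apply_of_ne _ _ _ _ hbj,
          Matrix.mul_transvection_apply_of_ne _ _ _ _ hbi, hmono, hT,
          Equiv.swap_apply_of_ne_of_ne hbi hbj, hdt b hbi hbj, if_neg hbj]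
        simp [Ne.symm hbj]
  · rw [Matrix.det_mul, Matrix.det_transvection_of_ne _ _ hij,
      Matrix.det_transvection_of_ne _ _ hij.symm, one_mul]
  · intro t
    rw [act_X_of_monomial hmono]
    by_cases hti : t = i
    · subst hti
      rw [hdi, Equiv.swap_apply_left]
      have h1 : (C z⁻¹ * C z : MvPolynomial (Fin n) ℂ) = 1 := by
        rw [← C_mul, inv_mul_cancel₀ hz0, C_1]
      refine ⟨C z⁻¹, ?_⟩
      rw [mirrorForm]
      linear_combination X t * h1
    · by_cases htj : t = j
      · subst htj
        rw [hdj, Equiv.swap_apply_right]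
        refine ⟨-1, ?_⟩
        rw [mirrorForm]
        ring
      · rw [hdt t hti htj, Equiv.swap_apply_of_ne_of_ne hti htj, C_1, one_mul, sub_self]
        exact dvd_zero _

theorem det_pow_dvd_of_isInvariantForm {r p n k : ℕ} (hr : 0 < r) (hp : 0 < p) (hpr : p ∣ r)
    (hn : 0 < n) {ξ : ℂ} (hξ : IsPrimitiveRoot ξ r)
    (F : (Fin n → MvPolynomial (Fin n) ℂ) [⋀^Fin k]→ₗ[MvPolynomial (Fin n) ℂ]
      MvPolynomial (Fin n) ℂ) (hF : IsInvariantForm r p n (restrictForm F)) (g : Fin k → Fin n) :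
    (thetaMatrix r p n).det ^ k ∣ F ((thetaMatrix r p n).adjugate.col ∘ g) := by
  obtain ⟨ε, hε, h⟩ := det_thetaMatrix (p := p) hr hn hξ
  rw [h, mul_pow, (hε.pow k).mul_left_dvd, mul_pow]
  have h1 : (∏ x ∈ mirrors r n, mirrorForm x) ^ k ∣
      F ((thetaMatrix r p n).adjugate.col ∘ g) := by
    rw [← Finset.prod_pow]
    refine Finset.prod_dvd_of_isRelPrime (fun x hx y hy hxy => ?_) fun x hx => ?_
    · exact (isRelPrime_mirrorForm (mem_mirrors hr hx).1 (mem_mirrors hr hy).1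
        (mem_mirrors hr hy).2.2 hxy).pow
    · exact mirrorForm_pow_dvd_of_isInvariantForm hr F hF (mem_mirrors hr hx).1.ne
        (mem_mirrors hr hx).2.1 g
  split_ifs with hne
  · rwa [one_pow, one_mul]
  · refine IsRelPrime.mul_dvd ?_ ?_ h1
    · refine IsRelPrime.pow (IsRelPrime.prod_left fun i _ => IsRelPrime.prod_right fun x hx => ?_)
      exact isRelPrime_X_mirrorForm i (mem_mirrors hr hx).1.ne (mem_mirrors hr hx).2.2
    · rw [← Finset.prod_pow]
      refine Finset.prod_dvd_of_isRelPrime (fun x _ y _ hxy => (isRelPrime_X hxy).pow) fun i _ => ?_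
      exact X_pow_dvd_of_isInvariantForm hr hp hpr hne hξ F hF i g

theorem wedge_theta_independent {r p n k : ℕ} (hr : 0 < r) (hn : 0 < n) {ξ : ℂ}
    (hξ : IsPrimitiveRoot ξ r) (c : (Fin k → Fin n) → MvPolynomial (Fin n) ℂ)
    (h : ∀ w, (∑ I ∈ Finset.univ.filter (fun I : Fin k → Fin n => StrictMono I),
      c I • wedge k fun b => theta r p n (I b)) w = 0) (J : Fin k → Fin n) (hJ : StrictMono J) :
    c J = 0 := by
  refine rowWedge_independent (thetaMatrix r p n) (det_thetaMatrix_ne_zero hr hn hξ) c ?_ J hJ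
  refine eq_zero_of_restrictForm_eq_zero _ fun w => ?_
  rw [restrictForm_sum_smul]
  simpa only [wedge_theta_eq] using h w

theorem act_sum_smul_wedge_theta {r p n k : ℕ} (hr : 0 < r) {M : Matrix (Fin n) (Fin n) ℂ}
    (hM : M ∈ GG r p n) (T : Finset (Fin k → Fin n))
    (c : (Fin k → Fin n) → MvPolynomial (Fin n) ℂ) (w : Fin k → EuclideanSpace ℂ (Fin n)) :
    act M ((∑ I ∈ T, c I • wedge k fun b => theta r p n (I b)) w) =
      (∑ I ∈ T, act M (c I) • wedge k fun b => theta r p n (I b))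
        fun i => Matrix.toEuclideanLin M (w i) := by
  rw [alternatingMap_sum_apply, alternatingMap_sum_apply, map_sum]
  refine Finset.sum_congr rfl fun I _ => ?_
  rw [AlternatingMap.smul_apply, AlternatingMap.smul_apply, smul_eq_mul, smul_eq_mul, map_mul,
    act_wedge_theta hr hM]

theorem exists_eq_sum_of_isInvariantForm {r p n k : ℕ} (hr : 0 < r) (hp : 0 < p) (hpr : p ∣ r)
    (hn : 0 < n) {ξ : ℂ} (hξ : IsPrimitiveRoot ξ r)
    (s : (EuclideanSpace ℂ (Fin n)) [⋀^Fin k]→ₗ[ℂ] MvPolynomial (Fin n) ℂ)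
    (hs : IsInvariantForm r p n s) :
    ∃ c : (Fin k → Fin n) → MvPolynomial (Fin n) ℂ,
      s = ∑ I ∈ Finset.univ.filter (fun I : Fin k → Fin n => StrictMono I),
        c I • wedge k fun b => theta r p n (I b) := by
  obtain ⟨F, rfl⟩ := exists_restrictForm_eq s
  choose c hc using det_pow_dvd_of_isInvariantForm hr hp hpr hn hξ F hs
  refine ⟨c, ?_⟩
  have hdet := det_thetaMatrix_ne_zero (p := p) hr hn hξ
  have hF : F = ∑ I ∈ Finset.univ.filter (fun I : Fin k → Fin n => StrictMono I),
      c I • rowWedge (thetaMatrix r p n) I := by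
    have h := det_pow_smul_eq_sum_rowWedge (thetaMatrix r p n) hdet F
    simp only [hc, mul_smul] at h
    rw [← Finset.smul_sum] at h
    ext1 x
    exact mul_left_cancel₀ (pow_ne_zero k hdet) (DFunLike.congr_fun h x)
  simp only [wedge_theta_eq]
  rw [← restrictForm_sum_smul, ← hF]

theorem act_coeff_eq_of_isInvariantForm {r p n k : ℕ} (hr : 0 < r) (hn : 0 < n) {ξ : ℂ}
    (hξ : IsPrimitiveRoot ξ r) (c : (Fin k → Fin n) → MvPolynomial (Fin n) ℂ)
    (hs : IsInvariantForm r p n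
      (∑ I ∈ Finset.univ.filter (fun I : Fin k → Fin n => StrictMono I),
        c I • wedge k fun b => theta r p n (I b)))
    {M : Matrix (Fin n) (Fin n) ℂ} (hM : M ∈ GG r p n) (J : Fin k → Fin n) (hJ : StrictMono J) :
    act M (c J) = c J := by
  rw [← sub_eq_zero]
  refine wedge_theta_independent (p := p) hr hn hξ (fun I => act M (c I) - c I) (fun w => ?_) J hJ
  choose v hv using fun i => toEuclideanLin_surjective_of_mem hr hM (w i)
  have h := hs M hM v
  rw [act_sum_smul_wedge_theta hr hM] at h
  simp only [hv] at h
  rw [alternatingMap_sum_apply, alternatingMap_sum_apply] at h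
  rw [alternatingMap_sum_apply, ← sub_eq_zero.2 h, ← Finset.sum_sub_distrib]
  refine Finset.sum_congr rfl fun I _ => ?_
  rw [AlternatingMap.smul_apply, AlternatingMap.smul_apply, AlternatingMap.smul_apply, smul_eq_mul,
    smul_eq_mul, smul_eq_mul, sub_mul]

/-- Let `G = G(r,p,n)` act on `V = ℂⁿ` and contragrediently on `V^*`.
For every `1 ≤ k ≤ n`, the `G(r,p,n)`-invariants of `S(V) ⊗ ⋀^k(V^*)` (realized as
alternating `k`-multilinear maps `V^k → S(V)`, with the diagonal action) form the free
`S(V)^{G(r,p,n)}`-module with basis the wedge products `θ_{i₁} ∧ ⋯ ∧ θ_{i_k}` for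
`1 ≤ i₁ < ⋯ < i_k ≤ n`. -/
theorem invariant_derivations_of_Grpn
    (r p n : ℕ) (hr : 0 < r) (hp : 0 < p) (hpr : p ∣ r) (hn : 0 < n)
    (ξ : ℂ) (hξ : IsPrimitiveRoot ξ r)
    (k : ℕ) (hk1 : 1 ≤ k) (hkn : k ≤ n)
    (monos : Finset (Fin k → Fin n))
    (hmonos : monos = Finset.univ.filter fun ι : Fin k → Fin n => StrictMono ι) :
    ({s : (EuclideanSpace ℂ (Fin n)) [⋀^Fin k]→ₗ[ℂ] MvPolynomial (Fin n) ℂ |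
        ∀ M ∈ GG r p n, ∀ w, act M (s w) = s fun i => Matrix.toEuclideanLin M (w i)}
      = {s | ∃ c : (Fin k → Fin n) → MvPolynomial (Fin n) ℂ,
          (∀ ι ∈ monos, ∀ M ∈ GG r p n, act M (c ι) = c ι) ∧
          s = ∑ ι ∈ monos, c ι • wedge k fun b => theta r p n (ι b)})
    ∧ ∀ c : (Fin k → Fin n) → MvPolynomial (Fin n) ℂ,
        (∀ ι ∈ monos, ∀ M ∈ GG r p n, act M (c ι) = c ι) →
        (∑ ι ∈ monos, c ι • wedge k fun b => theta r p n (ι b)) = 0 →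
        ∀ ι ∈ monos, c ι = 0 := by
  subst hmonos
  refine ⟨Set.ext fun s => ⟨fun hs => ?_, ?_⟩, fun c _ h ι hι => ?_⟩
  · obtain ⟨c, rfl⟩ := exists_eq_sum_of_isInvariantForm hr hp hpr hn hξ s hs
    exact ⟨c, fun ι hι M hM => act_coeff_eq_of_isInvariantForm hr hn hξ c hs hM ι
      (Finset.mem_filter.1 hι).2, rfl⟩
  · rintro ⟨c, hc, rfl⟩ M hM w
    rw [act_sum_smul_wedge_theta hr hM]
    congr 1
    exact Finset.sum_congr rfl fun ι hι => by rw [hc ι hι M hM]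
  · exact wedge_theta_independent hr hn hξ c (fun w => by rw [h]; rfl) ι (Finset.mem_filter.1 hι).2

end
end

section
/- Let G = G(r,1,n) act on V = ℂ^n via the nonfaithful representation ρ, and let g = ξ^{a_1}I_{n_1} ⊕ ⋯ ⊕ ξ^{a_k}I_{n_k} be block-scalar with ξ^{a_1},…,ξ^{a_k} pairwise distinct. For each block i define θ^{(i)}_j = Σ_{l=1}^{n_i} (v^{(i)}_l)^{j−1} ⊗ x^{(i)}_l ∈ S(V_i) ⊗ V_i^* for 1 ≤ j ≤ n_i (the basic derivations for the permutation action of 𝔖_{n_i} on V_i). Then the Z(g)-invariants (via ρ, with the diagonal action and contragredient action on V^*) of S(V) ⊗ ⋀^2(V^*) form the free S(V)^{Z(g)}-module with basis the wedge products θ^{(i)}_j ∧ θ^{(i')}_{j'} taken over pairs with i < i', or i = i' and j < j': (S(V) ⊗ ⋀^2(V^*))^{Z(g)} = ⨁ S(V)^{Z(g)} · (θ^{(i)}_j ∧ θ^{(i')}_{j'}). -/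
open MvPolynomial Matrix Finset

attribute [local instance] Classical.propDecidable

noncomputable section

/-- The basic derivation `θ⁽ⁱ⁾_j = ∑_{l in block i} v_l^j ⊗ x_l` for the permutation
action of `𝔖_{n_i}` on the `i`-th block (here `j : ℕ` is the exponent, i.e. the paper's
`θ⁽ⁱ⁾_{j+1}`). -/
def thetaBlock {n k : ℕ} (b : Fin n → Fin k) (u : Fin k × Fin n) :
    EuclideanSpace ℂ (Fin n) →ₗ[ℂ] MvPolynomial (Fin n) ℂ :=
  oneForm fun l => if b l = u.1 then X l ^ (u.2 : ℕ) else 0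

theorem MvPolynomial.irreducible_X_sub_X {σ K : Type*} [Field K] {p q : σ} (h : p ≠ q) :
    Irreducible (X p - X q : MvPolynomial σ K) := by
  classical
  have : (X p - X q : MvPolynomial σ K) =
      sumSMulX (Finsupp.single p (1 : K) - Finsupp.single q 1) := by
    simp [sumSMulX, Finsupp.linearCombination_single]
  rw [this]
  refine irreducible_sumSMulX _ ?_ ?_
  · exact ⟨p, by simp [h]⟩
  · intro r hr
    have := hr p
    rw [Finsupp.sub_apply, Finsupp.single_eq_same, Finsupp.single_eq_of_ne h] at this
    exact isUnit_of_dvd_one (by simpa using this)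

theorem MvPolynomial.isRelPrime_X_sub_X {σ K : Type*} [Field K] {p q r : σ}
    (hq : p ≠ q) (hr : p ≠ r) (hqr : q ≠ r) :
    IsRelPrime (X p - X q : MvPolynomial σ K) (X p - X r) := by
  classical
  rw [(irreducible_X_sub_X hq).isRelPrime_iff_not_dvd]
  intro h
  have := map_dvd (MvPolynomial.eval fun t => if t = r then (0 : K) else 1) h
  simp [hqr, hr] at this

theorem MvPolynomial.X_sub_X_dvd_sub_rename_swap {σ K : Type*} [CommRing K] [DecidableEq σ]
    (p q : σ) (f : MvPolynomial σ K) :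
    X p - X q ∣ f - rename (Equiv.swap p q) f := by
  rw [← Ideal.mem_span_singleton, ← Ideal.Quotient.eq]
  have hpq : Ideal.Quotient.mkₐ K (Ideal.span {(X p - X q : MvPolynomial σ K)}) (X p) =
      Ideal.Quotient.mkₐ K _ (X q) :=
    Ideal.Quotient.eq.2 (Ideal.mem_span_singleton_self _)
  refine DFunLike.congr_fun (f := Ideal.Quotient.mkₐ K (Ideal.span {X p - X q}))
    (g := (Ideal.Quotient.mkₐ K _).comp (rename (Equiv.swap p q))) (algHom_ext fun t => ?_) f
  by_cases h1 : t = p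
  · subst h1; simpa using hpq
  by_cases h2 : t = q
  · subst h2; simpa using hpq.symm
  simp [Equiv.swap_apply_of_ne_of_ne h1 h2]

/-- Newton interpolation at the variables of a multivariate polynomial ring. -/
theorem MvPolynomial.exists_interpolation {σ K : Type*} [Field K]
    (s : Finset σ) (f : σ → MvPolynomial σ K)
    (hf : ∀ p ∈ s, ∀ q ∈ s, X p - X q ∣ f p - f q) :
    ∃ P : Polynomial (MvPolynomial σ K), P.degree < s.card ∧ ∀ p ∈ s, P.eval (X p) = f p := by
  classical
  induction s using Finset.induction_on with
  | empty => exact ⟨0, by simp⟩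
  | insert a s ha ih =>
    obtain ⟨P, hdeg, hP⟩ := ih fun p hp q hq =>
      hf p (mem_insert_of_mem hp) q (mem_insert_of_mem hq)
    have hne : ∀ q ∈ s, a ≠ q := fun q hq h => ha (h ▸ hq)
    obtain ⟨d, hd⟩ : ∏ q ∈ s, (X a - X q) ∣ f a - P.eval (X a) := by
      refine Finset.prod_dvd_of_isRelPrime (fun q hq r hr hqr =>
        isRelPrime_X_sub_X (hne q hq) (hne r hr) hqr) fun q hq => ?_
      have h1 := hf a (mem_insert_self _ _) q (mem_insert_of_mem hq)
      have h2 := P.sub_dvd_eval_sub (X a) (X q)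
      rw [hP q hq] at h2
      have := dvd_sub h1 h2
      rwa [sub_sub_sub_cancel_right] at this
    refine ⟨P + Polynomial.C d * ∏ q ∈ s, (Polynomial.X - Polynomial.C (X q)), ?_, ?_⟩
    · rw [card_insert_of_notMem ha]
      refine lt_of_le_of_lt (Polynomial.degree_add_le _ _) (max_lt (hdeg.trans (by
        exact_mod_cast Nat.lt_succ_self _)) ?_)
      refine lt_of_le_of_lt ((Polynomial.degree_mul_le _ _).trans
        (add_le_add_left Polynomial.degree_C_le _)) ?_
      rw [zero_add, Polynomial.degree_prod]
      simp only [Polynomial.degree_X_sub_C, sum_const, nsmul_eq_mul, mul_one]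
      exact_mod_cast Nat.lt_succ_self _
    · intro p hp
      rw [mem_insert] at hp
      simp only [Polynomial.eval_add, Polynomial.eval_mul, Polynomial.eval_C,
        Polynomial.eval_prod, Polynomial.eval_sub, Polynomial.eval_X]
      rcases hp with rfl | hp
      · linear_combination -hd
      · rw [prod_eq_zero hp (sub_self _), mul_zero, add_zero, hP p hp]

/-- The coefficient of `x_p` in the basic derivation indexed by `u`. -/
def thetaCoeff {n k : ℕ} (b : Fin n → Fin k) (u : Fin k × Fin n) (p : Fin n) :
    MvPolynomial (Fin n) ℂ :=
  if b p = u.1 then X p ^ (u.2 : ℕ) else 0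

section

variable {n k : ℕ} {b : Fin n → Fin k} {m : Fin k → ℕ}

theorem sum_mul_thetaCoeff (c : Fin k × Fin n → MvPolynomial (Fin n) ℂ) (p : Fin n) :
    ∑ u, c u * thetaCoeff b u p = ∑ j : Fin n, c (b p, j) * X p ^ (j : ℕ) := by
  rw [Fintype.sum_prod_type]
  rw [Finset.sum_eq_single (b p)]
  · simp [thetaCoeff]
  · intro i _ hi
    simp [thetaCoeff, hi.symm]
  · simp

theorem rename_thetaCoeff {σ : Equiv.Perm (Fin n)} (hσ : ∀ p, b (σ p) = b p)
    (u : Fin k × Fin n) (p : Fin n) :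
    rename σ (thetaCoeff b u p) = thetaCoeff b u (σ p) := by
  unfold thetaCoeff
  rw [hσ]
  split_ifs <;> simp

theorem exists_eq_sum_mul_thetaCoeff
    (hm : ∀ i, (Finset.univ.filter fun t => b t = i).card = m i)
    (f : Fin n → MvPolynomial (Fin n) ℂ)
    (hf : ∀ p q, b p = b q → X p - X q ∣ f p - f q) :
    ∃ c : Fin k × Fin n → MvPolynomial (Fin n) ℂ,
      (∀ u, m u.1 ≤ u.2 → c u = 0) ∧ ∀ p, f p = ∑ u, c u * thetaCoeff b u p := by
  choose P hdeg hP using fun i => exists_interpolation (Finset.univ.filter fun t => b t = i) f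
    fun p hp q hq => hf p q (by simp_all)
  refine ⟨fun u => (P u.1).coeff u.2, fun u hu => ?_, fun p => ?_⟩
  · refine Polynomial.coeff_eq_zero_of_degree_lt ((hdeg u.1).trans_le ?_)
    rw [hm]
    exact_mod_cast hu
  · rw [sum_mul_thetaCoeff, ← hP (b p) p (by simp), Fin.sum_univ_eq_sum_range
      (fun j => (P (b p)).coeff j * X p ^ j)]
    have hlt : (P (b p)).degree < (n : ℕ) := (hdeg _).trans_le (by
      exact_mod_cast (card_le_univ _).trans (Fintype.card_fin n).le)
    by_cases h0 : P (b p) = 0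
    · simp [h0]
    · exact Polynomial.eval_eq_sum_range' ((Polynomial.natDegree_lt_iff_degree_lt h0).2 hlt) _

theorem eq_zero_of_sum_mul_thetaCoeff_eq_zero
    (hm : ∀ i, (Finset.univ.filter fun t => b t = i).card = m i)
    {c : Fin k × Fin n → MvPolynomial (Fin n) ℂ}
    (hc : ∀ u, m u.1 ≤ u.2 → c u = 0) (h : ∀ p, ∑ u, c u * thetaCoeff b u p = 0) : c = 0 := by
  funext ⟨i, j⟩
  let P : Polynomial (MvPolynomial (Fin n) ℂ) :=
    ∑ j : Fin n, Polynomial.C (c (i, j)) * Polynomial.X ^ (j : ℕ)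
  have hP : P = 0 := by
    refine Polynomial.eq_zero_of_degree_lt_of_eval_index_eq_zero
      (Finset.univ.filter fun t => b t = i) (v := X) (X_injective.injOn) ?_ fun p hp => ?_
    · refine (Polynomial.degree_sum_le _ _).trans_lt ?_
      rw [Finset.sup_lt_iff (WithBot.bot_lt_coe _)]
      intro j _
      by_cases hj : m i ≤ j
      · rw [hc (i, j) hj]
        simp
      · refine (Polynomial.degree_C_mul_X_pow_le _ _).trans_lt ?_
        rw [hm]
        exact_mod_cast not_le.1 hj
    · have := h p
      rw [sum_mul_thetaCoeff, (Finset.mem_filter.1 hp).2] at this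
      simpa [P, Polynomial.eval_finsetSum] using this
  have := congrArg (fun Q => Polynomial.coeff Q (j : ℕ)) hP
  simpa [P, Polynomial.finsetSum_coeff, Polynomial.coeff_C_mul, Polynomial.coeff_X_pow,
    Fin.val_inj] using this

theorem eq_of_sum_mul_thetaCoeff_eq
    (hm : ∀ i, (Finset.univ.filter fun t => b t = i).card = m i)
    {c d : Fin k × Fin n → MvPolynomial (Fin n) ℂ}
    (hc : ∀ u, m u.1 ≤ u.2 → c u = 0) (hd : ∀ u, m u.1 ≤ u.2 → d u = 0)
    (h : ∀ p, ∑ u, c u * thetaCoeff b u p = ∑ u, d u * thetaCoeff b u p) : c = d := by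
  refine sub_eq_zero.1 (eq_zero_of_sum_mul_thetaCoeff_eq_zero hm (c := c - d) (fun u hu => ?_)
    fun p => ?_)
  · simp [hc u hu, hd u hu]
  · simp [sub_mul, Finset.sum_sub_distrib, h p]

theorem apply_swap_eq {p q : Fin n} (hpq : b p = b q) (t : Fin n) :
    b (Equiv.swap p q t) = b t := by
  rw [Equiv.swap_apply_def]
  split_ifs <;> simp_all

theorem dvd_sub_of_rename_equivariant {f : Fin n → MvPolynomial (Fin n) ℂ}
    (hf : ∀ σ : Equiv.Perm (Fin n), (∀ p, b (σ p) = b p) → ∀ p, rename σ (f p) = f (σ p))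
    (p q : Fin n) (hpq : b p = b q) : X p - X q ∣ f p - f q := by
  have := X_sub_X_dvd_sub_rename_swap p q (f p)
  rwa [hf _ (apply_swap_eq hpq), Equiv.swap_apply_left] at this

theorem eq_of_sum_sum_thetaCoeff_eq
    (hm : ∀ i, (Finset.univ.filter fun t => b t = i).card = m i)
    {c d : Fin k × Fin n → Fin k × Fin n → MvPolynomial (Fin n) ℂ}
    (hc₁ : ∀ u v, m u.1 ≤ u.2 → c u v = 0) (hc₂ : ∀ u v, m v.1 ≤ v.2 → c u v = 0)
    (hd₁ : ∀ u v, m u.1 ≤ u.2 → d u v = 0) (hd₂ : ∀ u v, m v.1 ≤ v.2 → d u v = 0)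
    (h : ∀ p q, ∑ u, (∑ v, c u v * thetaCoeff b v q) * thetaCoeff b u p =
      ∑ u, (∑ v, d u v * thetaCoeff b v q) * thetaCoeff b u p) : c = d := by
  funext u
  refine eq_of_sum_mul_thetaCoeff_eq hm (fun v => hc₂ u v) (fun v => hd₂ u v) fun q => ?_
  refine congrFun (eq_of_sum_mul_thetaCoeff_eq hm (c := fun u => ∑ v, c u v * thetaCoeff b v q)
    (d := fun u => ∑ v, d u v * thetaCoeff b v q) (fun u hu => ?_) (fun u hu => ?_)
    fun p => h p q) u
  · simp [hc₁ u _ hu]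
  · simp [hd₁ u _ hu]

theorem exists_eq_sum_sum_thetaCoeff
    (hm : ∀ i, (Finset.univ.filter fun t => b t = i).card = m i)
    {A : Fin n → Fin n → MvPolynomial (Fin n) ℂ}
    (hA : ∀ p q, A p q = -A q p)
    (hσ : ∀ σ : Equiv.Perm (Fin n), (∀ p, b (σ p) = b p) →
      ∀ p q, rename σ (A p q) = A (σ p) (σ q)) :
    ∃ c : Fin k × Fin n → Fin k × Fin n → MvPolynomial (Fin n) ℂ,
      (∀ u v, m u.1 ≤ u.2 → c u v = 0) ∧ (∀ u v, m v.1 ≤ v.2 → c u v = 0) ∧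
      (∀ u v, c u v = -c v u) ∧
      (∀ σ : Equiv.Perm (Fin n), (∀ p, b (σ p) = b p) → ∀ u v, rename σ (c u v) = c u v) ∧
      ∀ p q, A p q = ∑ u, (∑ v, c u v * thetaCoeff b v q) * thetaCoeff b u p := by
  have hdvd : ∀ p q r, b q = b r → X q - X r ∣ A p q - A p r := by
    have key : ∀ p q, b p = b q → X p - X q ∣ A p q := by
      intro p q hpq
      have h := X_sub_X_dvd_sub_rename_swap p q (A p q)
      rw [hσ _ (apply_swap_eq hpq), Equiv.swap_apply_left, Equiv.swap_apply_right, hA q p,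
        sub_neg_eq_add] at h
      have h2 := h.mul_left (C (1 / 2 : ℂ))
      have : C (1 / 2 : ℂ) * (A p q + A p q) = A p q := by
        rw [← two_mul, ← mul_assoc, ← map_ofNat (C : ℂ →+* MvPolynomial (Fin n) ℂ) 2, ← C_mul]
        norm_num
      rwa [this] at h2
    have diag : ∀ p, A p p = 0 := fun p => self_eq_neg.1 (hA p p)
    intro p q r hqr
    by_cases hq : q = p
    · subst hq
      rw [diag, zero_sub, dvd_neg]
      exact key _ _ hqr
    by_cases hr : r = p
    · subst hr
      rw [diag, sub_zero, ← neg_sub, neg_dvd]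
      exact key _ _ hqr.symm
    have h := X_sub_X_dvd_sub_rename_swap q r (A p q)
    rwa [hσ _ (apply_swap_eq hqr), Equiv.swap_apply_left,
      Equiv.swap_apply_of_ne_of_ne (Ne.symm hq) (Ne.symm hr)] at h
  choose B hB0 hB using fun p => exists_eq_sum_mul_thetaCoeff hm (A p) (hdvd p)
  have hBσ : ∀ σ : Equiv.Perm (Fin n), (∀ p, b (σ p) = b p) →
      ∀ p u, rename σ (B p u) = B (σ p) u := by
    intro σ hbσ p u
    refine congrFun (eq_of_sum_mul_thetaCoeff_eq hm (c := fun u => rename σ (B p u))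
      (fun u hu => by simp [hB0 p u hu]) (hB0 (σ p)) fun q => ?_) u
    obtain ⟨q, rfl⟩ := σ.surjective q
    rw [← hB, ← hσ σ hbσ, hB p q, map_sum]
    simp_rw [map_mul, rename_thetaCoeff hbσ]
  choose D hD0 hD using fun u => exists_eq_sum_mul_thetaCoeff hm (fun p => B p u)
    (dvd_sub_of_rename_equivariant fun σ hbσ p => hBσ σ hbσ p u)
  have hD0' : ∀ u v, m u.1 ≤ u.2 → D u v = 0 := fun u v hu =>
    congrFun (eq_zero_of_sum_mul_thetaCoeff_eq_zero hm (hD0 u) fun p => by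
      rw [← hD, hB0 p u hu]) v
  have hAD : ∀ p q, A p q = ∑ u, (∑ v, D u v * thetaCoeff b v p) * thetaCoeff b u q := by
    intro p q
    rw [hB]
    simp_rw [← hD]
  have hAD' : ∀ p q, A p q = ∑ u, (∑ v, -D u v * thetaCoeff b v q) * thetaCoeff b u p := by
    intro p q
    simp [hA p q, hAD q p]
  refine ⟨fun u v => -D u v, fun u v hu => by simp [hD0' u v hu],
    fun u v hv => by simp [hD0 u v hv], fun u v => ?_, fun σ hbσ u v => ?_, hAD'⟩
  · refine congrFun (congrFun (eq_of_sum_sum_thetaCoeff_eq hm (c := fun u v => -D u v)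
      (d := fun u v => - -D v u) (fun u v hu => by simp [hD0' u v hu])
      (fun u v hv => by simp [hD0 u v hv]) (fun u v hu => by simp [hD0 v u hu])
      (fun u v hv => by simp [hD0' v u hv]) fun p q => ?_) u) v
    rw [← hAD', hAD]
    simp_rw [neg_neg, Finset.sum_mul]
    rw [Finset.sum_comm]
    exact Finset.sum_congr rfl fun _ _ => Finset.sum_congr rfl fun _ _ => by ring
  · rw [map_neg, neg_inj]
    refine congrFun (eq_of_sum_mul_thetaCoeff_eq hm (c := fun v => rename σ (D u v))
      (fun v hv => by simp [hD0 u v hv]) (hD0 u) fun p => ?_) v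
    obtain ⟨p, rfl⟩ := σ.surjective p
    rw [← hD, ← hBσ σ hbσ, hD, map_sum]
    simp_rw [map_mul, rename_thetaCoeff hbσ]

theorem sum_pairs_eq_sum_sum {ι R : Type*} [Fintype ι] [CommRing R]
    (S : Finset (ι × ι)) (c : ι × ι → R) (x y : ι → R) :
    ∑ uv ∈ S, c uv * (x uv.1 * y uv.2 - x uv.2 * y uv.1) =
      ∑ u, (∑ v, ((if (u, v) ∈ S then c (u, v) else 0) -
        if (v, u) ∈ S then c (v, u) else 0) * y v) * x u := by
  have h : ∑ uv ∈ S, c uv * (x uv.1 * y uv.2 - x uv.2 * y uv.1) =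
      ∑ u, ∑ v, (if (u, v) ∈ S then c (u, v) else 0) * (x u * y v - x v * y u) := by
    rw [← Fintype.sum_prod_type'
      (f := fun u v => (if (u, v) ∈ S then c (u, v) else 0) * (x u * y v - x v * y u))]
    simp [Finset.sum_ite_mem, ite_mul]
  rw [h]
  simp_rw [mul_sub, Finset.sum_sub_distrib, Finset.sum_mul, sub_mul, Finset.sum_sub_distrib]
  congr 1
  · exact Finset.sum_congr rfl fun _ _ => Finset.sum_congr rfl fun _ _ => by ring
  · rw [Finset.sum_comm]
    exact Finset.sum_congr rfl fun _ _ => Finset.sum_congr rfl fun _ _ => by ring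

/-- The permutation matrix sending the `j`-th basis vector to the `σ j`-th one. -/
def permMat (σ : Equiv.Perm (Fin n)) : Matrix (Fin n) (Fin n) ℂ :=
  Matrix.of fun i j => if i = σ j then 1 else 0

theorem act_permMat (σ : Equiv.Perm (Fin n)) (f : MvPolynomial (Fin n) ℂ) :
    act (permMat σ) f = rename σ f := by
  refine DFunLike.congr_fun (algHom_ext (f := act (permMat σ)) (g := rename σ) fun j => ?_) f
  simp [act, permMat]

/-- The standard basis of Euclidean space. -/
def stdE (p : Fin n) : EuclideanSpace ℂ (Fin n) := EuclideanSpace.single p 1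

theorem toEuclideanLin_permMat (σ : Equiv.Perm (Fin n)) (p : Fin n) :
    Matrix.toEuclideanLin (permMat σ) (stdE p) = stdE (σ p) := by
  ext i
  simp [stdE, permMat, Matrix.toLpLin_apply]

theorem thetaBlock_stdE (u : Fin k × Fin n) (p : Fin n) :
    thetaBlock b u (stdE p) = thetaCoeff b u p := by
  refine (Finset.sum_eq_single p (fun q _ hq => ?_) fun hp =>
    (hp (Finset.mem_univ p)).elim).trans ?_
  · simp [stdE, hq]
  · simp [stdE, thetaCoeff]

theorem wedge_two_apply (φ ψ : EuclideanSpace ℂ (Fin n) →ₗ[ℂ] MvPolynomial (Fin n) ℂ)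
    (x y : EuclideanSpace ℂ (Fin n)) :
    wedge 2 ![φ, ψ] ![x, y] = φ x * ψ y - ψ x * φ y :=
  Matrix.det_fin_two _

theorem alternating_ext_stdE {N : Type*} [AddCommMonoid N] [Module ℂ N]
    {s t : (EuclideanSpace ℂ (Fin n)) [⋀^Fin 2]→ₗ[ℂ] N}
    (h : ∀ p q, s ![stdE p, stdE q] = t ![stdE p, stdE q]) : s = t := by
  refine (EuclideanSpace.basisFun (Fin n) ℂ).toBasis.ext_alternating fun v _ => ?_
  have : (fun i => (EuclideanSpace.basisFun (Fin n) ℂ).toBasis (v i)) =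
      ![stdE (v 0), stdE (v 1)] := by
    funext i
    fin_cases i <;> simp [stdE]
  rw [this, h]

theorem alternating_swap {N : Type*} [AddCommGroup N] [Module ℂ N]
    (s : (EuclideanSpace ℂ (Fin n)) [⋀^Fin 2]→ₗ[ℂ] N) (x y : EuclideanSpace ℂ (Fin n)) :
    s ![x, y] = -s ![y, x] := by
  rw [← s.map_swap ![y, x] (i := 0) (j := 1) (by simp)]
  congr 1
  funext i
  fin_cases i <;> simp

theorem act_permMat_alternating_iff (σ : Equiv.Perm (Fin n))
    (s : (EuclideanSpace ℂ (Fin n)) [⋀^Fin 2]→ₗ[ℂ] MvPolynomial (Fin n) ℂ) :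
    (∀ w, act (permMat σ) (s w) = s fun i => Matrix.toEuclideanLin (permMat σ) (w i)) ↔
      ∀ p q, rename σ (s ![stdE p, stdE q]) = s ![stdE (σ p), stdE (σ q)] := by
  have hcomp : ∀ p q, (fun i => Matrix.toEuclideanLin (permMat σ)
      ((![stdE p, stdE q] : Fin 2 → EuclideanSpace ℂ (Fin n)) i)) =
        ![stdE (σ p), stdE (σ q)] := by
    intro p q
    funext i
    fin_cases i <;> simp [toEuclideanLin_permMat]
  refine ⟨fun h p q => ?_, fun h w => ?_⟩
  · rw [← act_permMat, h, hcomp]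
  · refine DFunLike.congr_fun (f := (act (permMat σ)).toLinearMap.compAlternatingMap s)
      (g := s.compLinearMap (Matrix.toEuclideanLin (permMat σ)))
      (alternating_ext_stdE fun p q => ?_) w
    refine (act_permMat σ _).trans ((h p q).trans ?_)
    rw [← hcomp]
    rfl

variable {r : ℕ} {z : Fin k → ℂ}

theorem exists_rho_eq_permMat (hr : 0 < r) (hz : Function.Injective z)
    {h : Matrix (Fin n) (Fin n) ℂ} (hG : h ∈ GG r 1 n)
    (hcomm : h * Matrix.diagonal (fun t => z (b t)) = Matrix.diagonal (fun t => z (b t)) * h) :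
    ∃ σ : Equiv.Perm (Fin n), (∀ p, b (σ p) = b p) ∧ rho h = permMat σ := by
  obtain ⟨⟨σ, d, hd, hM⟩, -⟩ := hG
  have hd0 : ∀ j, d j ≠ 0 := fun j h0 => by simpa [h0, hr.ne'] using hd j
  refine ⟨σ, fun p => hz ?_, ?_⟩
  · have := congrFun (congrFun hcomm (σ p)) p
    rw [Matrix.mul_diagonal, Matrix.diagonal_mul, hM, if_pos rfl, mul_comm] at this
    exact (mul_right_cancel₀ (hd0 p) this).symm
  · ext i j
    by_cases hij : i = σ j <;> simp [rho, permMat, hM, hij, hd0]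

theorem permMat_mem_GG (r : ℕ) (σ : Equiv.Perm (Fin n)) : permMat σ ∈ GG r 1 n := by
  refine ⟨⟨σ, fun _ => 1, by simp, fun i j => rfl⟩, ?_⟩
  have : ∀ i, ∑ j, permMat σ i j = 1 := fun i => by
    simp [permMat, ← Equiv.symm_apply_eq]
  simp [this]

theorem rho_permMat (σ : Equiv.Perm (Fin n)) : rho (permMat σ) = permMat σ := by
  ext i j
  by_cases hij : i = σ j <;> simp [rho, permMat, hij]

theorem permMat_mul_diagonal_comm {σ : Equiv.Perm (Fin n)} (hσ : ∀ p, b (σ p) = b p) :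
    permMat σ * Matrix.diagonal (fun t => z (b t)) =
      Matrix.diagonal (fun t => z (b t)) * permMat σ := by
  ext i j
  rw [Matrix.mul_diagonal, Matrix.diagonal_mul]
  by_cases hij : i = σ j <;> simp [permMat, hij, hσ]

theorem forall_rho_centralizer_iff (hr : 0 < r) (hz : Function.Injective z)
    (Q : Matrix (Fin n) (Fin n) ℂ → Prop) :
    (∀ h ∈ GG r 1 n, h * Matrix.diagonal (fun t => z (b t)) =
        Matrix.diagonal (fun t => z (b t)) * h → Q (rho h)) ↔
      ∀ σ : Equiv.Perm (Fin n), (∀ p, b (σ p) = b p) → Q (permMat σ) := by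
  refine ⟨fun H σ hσ => ?_, fun H h hG hcomm => ?_⟩
  · rw [← rho_permMat]
    exact H _ (permMat_mem_GG r σ) (permMat_mul_diagonal_comm hσ)
  · obtain ⟨σ, hσ, h_eq⟩ := exists_rho_eq_permMat hr hz hG hcomm
    rw [h_eq]
    exact H σ hσ

theorem sum_smul_wedge_stdE (S : Finset ((Fin k × Fin n) × (Fin k × Fin n)))
    (c : (Fin k × Fin n) × (Fin k × Fin n) → MvPolynomial (Fin n) ℂ) (p q : Fin n) :
    (∑ uv ∈ S, c uv • wedge 2 ![thetaBlock b uv.1, thetaBlock b uv.2]) ![stdE p, stdE q] =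
      ∑ u, (∑ v, ((if (u, v) ∈ S then c (u, v) else 0) -
        if (v, u) ∈ S then c (v, u) else 0) * thetaCoeff b v q) * thetaCoeff b u p := by
  have h := sum_pairs_eq_sum_sum S c (fun u => thetaCoeff b u p) (fun u => thetaCoeff b u q)
  refine Eq.trans ?_ (h.trans (by congr!))
  let ev : ((EuclideanSpace ℂ (Fin n)) [⋀^Fin 2]→ₗ[ℂ] MvPolynomial (Fin n) ℂ) →+
      MvPolynomial (Fin n) ℂ :=
    { toFun := fun s => s ![stdE p, stdE q]
      map_zero' := rfl
      map_add' := fun _ _ => rfl }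
  refine (map_sum ev _ S).trans ?_
  refine Finset.sum_congr rfl fun uv _ => ?_
  refine congrArg (c uv * ·) ((wedge_two_apply _ _ _ _).trans ?_)
  simp_rw [thetaBlock_stdE]

end

/-- Let `G = G(r,1,n)` act on `V = ℂⁿ` via the nonfaithful
representation `ρ` (realized by `act ∘ rho`), and let
`g = ξ^{a₁}I_{n₁} ⊕ ⋯ ⊕ ξ^{a_k}I_{n_k}` be block-scalar with `ξ^{a_i}` pairwise
distinct (blocks = fibers of the monotone map `b`, of cardinalities `m i`).  Then the
`Z(g)`-invariants of `S(V) ⊗ ⋀²(V^*)` (alternating bilinear maps `V² → S(V)`, with the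
diagonal action) form the free `S(V)^{Z(g)}`-module with basis the wedge products
`θ⁽ⁱ⁾_j ∧ θ⁽ⁱ'⁾_{j'}` over pairs with `i < i'`, or `i = i'` and `j < j'`. -/
theorem nonfaithful_invariant_two_forms_of_block_scalar
    (r n : ℕ) (hr : 0 < r) (ξ : ℂ) (hξ : IsPrimitiveRoot ξ r)
    (k : ℕ) (a : Fin k → ℕ) (hdist : Function.Injective fun i => ξ ^ a i)
    (b : Fin n → Fin k) (hb : Monotone b) (hbs : Function.Surjective b)
    (m : Fin k → ℕ) (hm : ∀ i, (Finset.univ.filter fun t => b t = i).card = m i)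
    (g : Matrix (Fin n) (Fin n) ℂ)
    (hg : g = Matrix.diagonal fun t => ξ ^ a (b t))
    (pairs : Finset ((Fin k × Fin n) × (Fin k × Fin n)))
    (hpairs : pairs = Finset.univ.filter fun uv =>
        (uv.1.2 : ℕ) < m uv.1.1 ∧ (uv.2.2 : ℕ) < m uv.2.1 ∧
        (uv.1.1 < uv.2.1 ∨ (uv.1.1 = uv.2.1 ∧ (uv.1.2 : ℕ) < (uv.2.2 : ℕ)))) :
    ({s : (EuclideanSpace ℂ (Fin n)) [⋀^Fin 2]→ₗ[ℂ] MvPolynomial (Fin n) ℂ |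
        ∀ h ∈ GG r 1 n, h * g = g * h →
          ∀ w, act (rho h) (s w) = s fun i => Matrix.toEuclideanLin (rho h) (w i)}
      = {s | ∃ c : (Fin k × Fin n) × (Fin k × Fin n) → MvPolynomial (Fin n) ℂ,
          (∀ uv ∈ pairs, ∀ h ∈ GG r 1 n, h * g = g * h →
              act (rho h) (c uv) = c uv) ∧
          s = ∑ uv ∈ pairs, c uv • wedge 2 ![thetaBlock b uv.1, thetaBlock b uv.2]})
    ∧ ∀ c : (Fin k × Fin n) × (Fin k × Fin n) → MvPolynomial (Fin n) ℂ,
        (∀ uv ∈ pairs, ∀ h ∈ GG r 1 n, h * g = g * h →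
            act (rho h) (c uv) = c uv) →
        (∑ uv ∈ pairs, c uv • wedge 2 ![thetaBlock b uv.1, thetaBlock b uv.2]) = 0 →
        ∀ uv ∈ pairs, c uv = 0 := by
  subst hg
  have hmem : ∀ uv, uv ∈ pairs ↔ (uv.1.2 : ℕ) < m uv.1.1 ∧ (uv.2.2 : ℕ) < m uv.2.1 ∧
        (uv.1.1 < uv.2.1 ∨ (uv.1.1 = uv.2.1 ∧ (uv.1.2 : ℕ) < (uv.2.2 : ℕ))) := by
    simp [hpairs]
  have hasymm : ∀ u v, (u, v) ∈ pairs → (v, u) ∉ pairs := by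
    intro u v h1 h2
    rw [hmem] at h1 h2
    dsimp only at h1 h2
    lia
  have htri : ∀ u v : Fin k × Fin n, (u.2 : ℕ) < m u.1 → (v.2 : ℕ) < m v.1 → u ≠ v →
      (u, v) ∈ pairs ∨ (v, u) ∈ pairs := by
    rintro ⟨i, j⟩ ⟨i', j'⟩ h1 h2 h3
    rw [hmem, hmem]
    rw [Ne, Prod.mk.injEq] at h3
    dsimp only at h1 h2 ⊢
    lia
  have hcoef : ∀ c : (Fin k × Fin n) × (Fin k × Fin n) → MvPolynomial (Fin n) ℂ,
      (∀ uv ∈ pairs, ∀ h ∈ GG r 1 n,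
        h * Matrix.diagonal (fun t => ξ ^ a (b t)) = Matrix.diagonal (fun t => ξ ^ a (b t)) * h →
          act (rho h) (c uv) = c uv) ↔
      ∀ uv ∈ pairs, ∀ σ : Equiv.Perm (Fin n), (∀ p, b (σ p) = b p) →
        rename σ (c uv) = c uv := by
    intro c
    refine forall₂_congr fun uv _ => ?_
    refine (forall_rho_centralizer_iff hr hdist fun M => act M (c uv) = c uv).trans ?_
    simp_rw [act_permMat]
  refine ⟨?_, fun c _ hsum uv huv => ?_⟩
  · ext s
    simp_rw [Set.mem_ofPred_eq, hcoef]
    refine (forall_rho_centralizer_iff hr hdist fun M =>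
      ∀ w, act M (s w) = s fun i => Matrix.toEuclideanLin M (w i)).trans ?_
    simp_rw [act_permMat_alternating_iff]
    constructor
    · intro hs
      obtain ⟨c, hc₁, hc₂, hanti, hinv, hc⟩ := exists_eq_sum_sum_thetaCoeff hm
        (A := fun p q => s ![stdE p, stdE q]) (fun p q => alternating_swap s _ _) hs
      refine ⟨fun uv => c uv.1 uv.2, fun uv _ σ hσ => hinv σ hσ _ _,
        alternating_ext_stdE fun p q => ?_⟩
      rw [sum_smul_wedge_stdE]
      refine (hc p q).trans (Finset.sum_congr rfl fun u _ => ?_)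
      congr 1
      refine Finset.sum_congr rfl fun v _ => ?_
      congr 1
      by_cases h1 : (u, v) ∈ pairs
      · simp [h1, hasymm _ _ h1]
      by_cases h2 : (v, u) ∈ pairs
      · simp [h1, h2, hanti u v]
      rw [if_neg h1, if_neg h2, sub_zero]
      by_cases hu : (u.2 : ℕ) < m u.1
      · by_cases hv : (v.2 : ℕ) < m v.1
        · obtain rfl : u = v := by
            by_contra hne
            exact (htri u v hu hv hne).elim h1 h2
          exact self_eq_neg.1 (hanti u u)
        · exact hc₂ u v (not_lt.1 hv)
      · exact hc₁ u v (not_lt.1 hu)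
    · rintro ⟨c, hc, rfl⟩ σ hσ p q
      rw [sum_smul_wedge_stdE, sum_smul_wedge_stdE, map_sum]
      simp_rw [map_mul, map_sum, map_mul, rename_thetaCoeff hσ, map_sub]
      refine Finset.sum_congr rfl fun u _ => ?_
      congr 1
      refine Finset.sum_congr rfl fun v _ => ?_
      congr 2
      · split_ifs with h
        · exact hc _ h σ hσ
        · simp
      · split_ifs with h
        · exact hc _ h σ hσ
        · simp
  · have h0 := eq_of_sum_sum_thetaCoeff_eq (b := b) hm
      (c := fun u v => (if (u, v) ∈ pairs then c (u, v) else 0) -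
        if (v, u) ∈ pairs then c (v, u) else 0) (d := 0) (fun u v hu => ?_) (fun u v hv => ?_)
      (fun _ _ _ => rfl) (fun _ _ _ => rfl) fun p q => ?_
    · have := congrFun (congrFun h0 uv.1) uv.2
      simpa [huv, hasymm _ _ huv] using this
    · have h1 : (u, v) ∉ pairs := fun h => hu.not_gt ((hmem _).1 h).1
      have h2 : (v, u) ∉ pairs := fun h => hu.not_gt ((hmem _).1 h).2.1
      simp [h1, h2]
    · have h1 : (u, v) ∉ pairs := fun h => hv.not_gt ((hmem _).1 h).2.1
      have h2 : (v, u) ∉ pairs := fun h => hv.not_gt ((hmem _).1 h).1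
      simp [h1, h2]
    · rw [← sum_smul_wedge_stdE, hsum]
      simp

end
end

section
/- Assume n ≥ 3 and let G = G(r,1,n) act on V = ℂ^n via the nonfaithful representation ρ. Let g = g_A ⊕ g_B ∈ G(r,1,n), where g_A ∈ G(r,1,3) is a 3×3 diagonal matrix times the 3-cycle (1,2,3), and g_B = ξ^{c_1}I_{m_1} ⊕ ⋯ ⊕ ξ^{c_k}I_{m_k} is a block-scalar diagonal matrix on the last n−3 coordinates with ξ^{c_1},…,ξ^{c_k} pairwise distinct. Then: (a) the fixed space V^g of ρ(g) is the span of v_1+v_2+v_3, v_4, …, v_n; (b) the Hochschild character χ_g of Z(g) (defined via ρ) is the trivial character; and (c) S(V^g)^{χ_g} = S(V^g)^{Z(g)} = ℂ[f_0, f^{(i)}_l : 1 ≤ i ≤ k, 1 ≤ l ≤ m_i], where f_0 = v_1+v_2+v_3 and f^{(i)}_l is the l-th elementary symmetric polynomial in the variables of the i-th block of g_B. -/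
open MvPolynomial Matrix Finset

attribute [local instance] Classical.propDecidable

noncomputable section

section BlockSymmetric

variable {ι K : Type*} [Field K]

/-- The elementary symmetric polynomial of degree `l` in the variables indexed by `S`. -/
def blockEsymm (K : Type*) [Field K] (S : Finset ι) (l : ℕ) : MvPolynomial ι K :=
  ∑ s ∈ Finset.powersetCard l S, ∏ t ∈ s, X t

lemma rename_val_esymm (S : Finset ι) (l : ℕ) :
    rename Subtype.val (esymm {x // x ∈ S} K l) = blockEsymm K S l := by
  rw [rename_eq_aeval, aeval_esymm_eq_multiset_esymm, blockEsymm, ← Finset.esymm_map_val]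
  congr 1
  change Multiset.map (X ∘ Subtype.val) S.attach.val = _
  rw [← Multiset.map_map]
  congr 1
  exact Multiset.attach_map_val _

lemma rename_blockEsymm (S : Finset ι) (l : ℕ) (π : Equiv.Perm ι)
    (hπ : ∀ t, π t ∈ S ↔ t ∈ S) :
    rename π (blockEsymm K S l) = blockEsymm K S l := by
  have hS : S.map π.toEmbedding = S := by
    ext t
    simp only [Finset.mem_map_equiv]
    rw [← hπ, Equiv.apply_symm_apply]
  conv_rhs => rw [blockEsymm, ← hS, powersetCard_map]
  simp [blockEsymm, mapEmbedding_apply]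

lemma MvPolynomial.IsSymmetric.mem_adjoin_esymm {σ : Type*} [Fintype σ] {p : MvPolynomial σ K}
    (hp : p.IsSymmetric) :
    p ∈ Algebra.adjoin K {q | ∃ l, 1 ≤ l ∧ l ≤ Fintype.card σ ∧ q = esymm σ K l} := by
  obtain ⟨q, hq⟩ := esymmAlgHom_surjective (σ := σ) (R := K) le_rfl ⟨p, hp⟩
  have : p = aeval (fun i : Fin (Fintype.card σ) => esymm σ K (i + 1)) q := by
    rw [← esymmAlgHom_apply, hq]
  have hrange : p ∈ Algebra.adjoin K
      (Set.range fun i : Fin (Fintype.card σ) => esymm σ K (i + 1)) := by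
    rw [Algebra.adjoin_range_eq_range_aeval]
    exact ⟨q, this.symm⟩
  refine Algebra.adjoin_mono ?_ hrange
  rintro _ ⟨i, rfl⟩
  exact ⟨i + 1, by omega, by omega, rfl⟩

variable [DecidableEq ι]

/-- The average of a polynomial over the permutations of the variables indexed by `S`. -/
def blockAverage (K : Type*) [Field K] (S : Finset ι) : MvPolynomial ι K →ₗ[K] MvPolynomial ι K :=
  (Fintype.card (Equiv.Perm {x // x ∈ S}) : K)⁻¹ •
    ∑ π : Equiv.Perm {x // x ∈ S}, (rename (Equiv.Perm.ofSubtype π : ι → ι)).toLinearMap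

lemma blockAverage_apply (S : Finset ι) (f : MvPolynomial ι K) :
    blockAverage K S f = (Fintype.card (Equiv.Perm {x // x ∈ S}) : K)⁻¹ •
      ∑ π : Equiv.Perm {x // x ∈ S}, rename (Equiv.Perm.ofSubtype π : ι → ι) f := by
  simp [blockAverage]

lemma blockAverage_mul (S : Finset ι) (p q : MvPolynomial ι K)
    (hp : ∀ π : Equiv.Perm {x // x ∈ S}, rename (Equiv.Perm.ofSubtype π : ι → ι) p = p) :
    blockAverage K S (p * q) = p * blockAverage K S q := by
  simp only [blockAverage_apply, map_mul, hp, ← Finset.mul_sum, mul_smul_comm]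

lemma blockAverage_of_invariant [CharZero K] (S : Finset ι) (p : MvPolynomial ι K)
    (hp : ∀ π : Equiv.Perm {x // x ∈ S}, rename (Equiv.Perm.ofSubtype π : ι → ι) p = p) :
    blockAverage K S p = p := by
  simp only [blockAverage_apply, hp, Finset.sum_const, Finset.card_univ]
  rw [← Nat.cast_smul_eq_nsmul K, smul_smul, inv_mul_cancel₀, one_smul]
  exact Nat.cast_ne_zero.2 Fintype.card_ne_zero

lemma blockAverage_rename_val_mem (S : Finset ι) (q : MvPolynomial {x // x ∈ S} K) :
    blockAverage K S (rename Subtype.val q) ∈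
      Algebra.adjoin K {q | ∃ l, 1 ≤ l ∧ l ≤ S.card ∧ q = blockEsymm K S l} := by
  have hcomp (π : Equiv.Perm {x // x ∈ S}) :
      rename (Equiv.Perm.ofSubtype π : ι → ι) (rename Subtype.val q) =
        rename Subtype.val (rename π q) := by
    rw [rename_rename, rename_rename]
    congr 2
    ext x
    simp
  have hsym : (∑ π : Equiv.Perm {x // x ∈ S}, rename π q).IsSymmetric := by
    intro e
    rw [map_sum]
    refine Fintype.sum_equiv (Equiv.mulLeft e) _ _ fun π => ?_
    rw [rename_rename]
    rfl
  have hmem := Subalgebra.mem_map.2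
    ⟨_, hsym.mem_adjoin_esymm, (rfl : rename (Subtype.val : {x // x ∈ S} → ι) _ = _)⟩
  rw [AlgHom.map_adjoin, map_sum] at hmem
  rw [blockAverage_apply]
  simp only [hcomp]
  refine Subalgebra.smul_mem _ (Algebra.adjoin_mono ?_ hmem) _
  rintro _ ⟨_, ⟨l, h1, h2, rfl⟩, rfl⟩
  exact ⟨l, h1, by simpa using h2, rename_val_esymm S l⟩

lemma mem_adjoin_blockEsymm_of_invariant [CharZero K] (S : Finset ι)
    (T : Set (MvPolynomial ι K))
    (hT : ∀ p ∈ T, ∀ π : Equiv.Perm {x // x ∈ S},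
      rename (Equiv.Perm.ofSubtype π : ι → ι) p = p)
    {f : MvPolynomial ι K} (hf : f ∈ Algebra.adjoin K (T ∪ X '' (S : Set ι)))
    (hinv : ∀ π : Equiv.Perm {x // x ∈ S}, rename (Equiv.Perm.ofSubtype π : ι → ι) f = f) :
    f ∈ Algebra.adjoin K (T ∪ {q | ∃ l, 1 ≤ l ∧ l ≤ S.card ∧ q = blockEsymm K S l}) := by
  have hT' : ∀ p ∈ Algebra.adjoin K T, ∀ π : Equiv.Perm {x // x ∈ S},
      rename (Equiv.Perm.ofSubtype π : ι → ι) p = p := by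
    intro p hp π
    have : Algebra.adjoin K T ≤ AlgHom.equalizer
        (rename (Equiv.Perm.ofSubtype π : ι → ι)) (AlgHom.id K _) :=
      Algebra.adjoin_le fun p hp => hT p hp π
    exact this hp
  rw [← blockAverage_of_invariant S f hinv]
  rw [← Subalgebra.mem_toSubmodule, Algebra.adjoin_union_coe_submodule] at hf
  refine Submodule.mul_induction_on hf (fun p hp q hq => ?_) fun p q hp hq => ?_
  · rw [blockAverage_mul S p q (hT' p hp)]
    have hX : X '' (S : Set ι) = Set.range
        (X ∘ Subtype.val : {x // x ∈ S} → MvPolynomial ι K) := by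
      ext; simp
    rw [Subalgebra.mem_toSubmodule, hX, Algebra.adjoin_range_eq_range_aeval,
      ← rename_eq_aeval] at hq
    obtain ⟨q, rfl⟩ := hq
    exact Subalgebra.mul_mem _ (Algebra.adjoin_mono Set.subset_union_left hp)
      (Algebra.adjoin_mono Set.subset_union_right (blockAverage_rename_val_mem S q))
  · rw [map_add]
    exact Subalgebra.add_mem _ hp hq

lemma mem_adjoin_blockEsymm_of_blockInvariant [CharZero K] {κ : Type*} [Fintype κ]
    (B : κ → Finset ι) (hB : Pairwise fun i j => Disjoint (B i) (B j))
    (T : Set (MvPolynomial ι K))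
    (hT : ∀ p ∈ T, ∀ i, ∀ π : Equiv.Perm {x // x ∈ B i},
      rename (Equiv.Perm.ofSubtype π : ι → ι) p = p)
    {f : MvPolynomial ι K} (hf : f ∈ Algebra.adjoin K (T ∪ {q | ∃ i, ∃ t ∈ B i, q = X t}))
    (hinv : ∀ i, ∀ π : Equiv.Perm {x // x ∈ B i},
      rename (Equiv.Perm.ofSubtype π : ι → ι) f = f) :
    f ∈ Algebra.adjoin K
      (T ∪ {q | ∃ i l, 1 ≤ l ∧ l ≤ (B i).card ∧ q = blockEsymm K (B i) l}) := by
  have key (J : Finset κ) : f ∈ Algebra.adjoin K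
      (T ∪ {q | ∃ i ∈ J, ∃ l, 1 ≤ l ∧ l ≤ (B i).card ∧ q = blockEsymm K (B i) l} ∪
        {q | ∃ i ∉ J, ∃ t ∈ B i, q = X t}) := by
    induction J using Finset.induction_on with
    | empty => simpa using hf
    | insert i J hi ih =>
      refine Algebra.adjoin_mono ?_ (mem_adjoin_blockEsymm_of_invariant (B i)
        (T ∪ {q | ∃ i ∈ J, ∃ l, 1 ≤ l ∧ l ≤ (B i).card ∧ q = blockEsymm K (B i) l} ∪
          {q | ∃ j ∉ insert i J, ∃ t ∈ B j, q = X t}) ?_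
        (Algebra.adjoin_mono ?_ ih) (hinv i))
      · rintro _ (((h | ⟨j, hj, l, hl⟩) | h) | ⟨l, hl⟩)
        · exact Or.inl (Or.inl h)
        · exact Or.inl (Or.inr ⟨j, Finset.mem_insert_of_mem hj, l, hl⟩)
        · exact Or.inr h
        · exact Or.inl (Or.inr ⟨i, Finset.mem_insert_self i J, l, hl⟩)
      · rintro _ ((h | ⟨j, hj, l, hl1, hl2, rfl⟩) | ⟨j, hj, t, ht, rfl⟩) π
        · exact hT _ h i π
        · refine rename_blockEsymm _ _ _ fun t => ?_
          have hij : Disjoint (B i) (B j) := hB fun h => hi (h ▸ hj)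
          by_cases ht : t ∈ B i
          · have h1 : Equiv.Perm.ofSubtype π t ∈ B i :=
              (Equiv.Perm.ofSubtype_apply_mem_iff_mem π t).2 ht
            exact iff_of_false (Finset.disjoint_left.1 hij h1) (Finset.disjoint_left.1 hij ht)
          · rw [Equiv.Perm.ofSubtype_apply_of_not_mem π ht]
        · have hij : Disjoint (B i) (B j) := hB fun h => hj (h ▸ Finset.mem_insert_self i J)
          rw [rename_X, Equiv.Perm.ofSubtype_apply_of_not_mem π (Finset.disjoint_right.1 hij ht)]
      · rintro _ ((h | h) | ⟨j, hj, t, ht, rfl⟩)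
        · exact Or.inl (Or.inl (Or.inl h))
        · exact Or.inl (Or.inl (Or.inr h))
        · by_cases hji : j = i
          · subst hji
            exact Or.inr ⟨t, ht, rfl⟩
          · exact Or.inl (Or.inr ⟨j, by simp [hji, hj], t, ht, rfl⟩)
  simpa using key Finset.univ

end BlockSymmetric

section PermutationMatrices

variable {n : ℕ}

/-- The permutation matrix sending the `j`-th basis vector to the `π j`-th one. -/
def columnPermMatrix (π : Equiv.Perm (Fin n)) : Matrix (Fin n) (Fin n) ℂ :=
  Matrix.of fun i j => if i = π j then 1 else 0

/-- The endomorphism of `ℂⁿ` permuting the standard basis vectors by `π`. -/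
def permEnd (π : Equiv.Perm (Fin n)) :
    EuclideanSpace ℂ (Fin n) →ₗ[ℂ] EuclideanSpace ℂ (Fin n) :=
  Matrix.toEuclideanLin (columnPermMatrix π)

lemma rho_monomial (M : Matrix (Fin n) (Fin n) ℂ) (π : Equiv.Perm (Fin n)) (d : Fin n → ℂ)
    (hd : ∀ j, d j ≠ 0) (hM : ∀ i j, M i j = if i = π j then d j else 0) :
    rho M = columnPermMatrix π := by
  ext i j
  by_cases h : i = π j <;> simp [rho, columnPermMatrix, hM, h, hd]

lemma act_columnPermMatrix (π : Equiv.Perm (Fin n)) :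
    act (columnPermMatrix π) = rename π := by
  ext j
  simp [act, columnPermMatrix]

lemma columnPermMatrix_mulVec (π : Equiv.Perm (Fin n)) (x : Fin n → ℂ) (i : Fin n) :
    (columnPermMatrix π).mulVec x i = x (π.symm i) := by
  simp [columnPermMatrix, Matrix.mulVec, dotProduct, ← Equiv.symm_apply_eq]

lemma permEnd_apply (π : Equiv.Perm (Fin n)) (x : EuclideanSpace ℂ (Fin n)) (i : Fin n) :
    permEnd π x i = x (π.symm i) := by
  rw [permEnd, Matrix.toLpLin_apply]
  exact columnPermMatrix_mulVec π x i

lemma permEnd_mul (π τ : Equiv.Perm (Fin n)) : permEnd (π * τ) = permEnd π ∘ₗ permEnd τ := by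
  ext x i
  simp only [LinearMap.comp_apply, permEnd_apply]
  rfl

lemma permEnd_one : permEnd (1 : Equiv.Perm (Fin n)) = LinearMap.id := by
  ext x i
  simp only [LinearMap.id_apply, permEnd_apply]
  rfl

lemma columnPermMatrix_mem_GG (r : ℕ) (π : Equiv.Perm (Fin n)) :
    columnPermMatrix π ∈ GG r 1 n := by
  refine ⟨⟨π, fun _ => 1, by simp, fun i j => rfl⟩, ?_⟩
  simp [columnPermMatrix, ← Equiv.symm_apply_eq]

lemma columnPermMatrix_mul_comm_monomial (π σ : Equiv.Perm (Fin n)) (e : Fin n → ℂ)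
    (hπσ : ∀ j, π (σ j) = σ (π j)) (he : ∀ j, e (π j) = e j)
    (g : Matrix (Fin n) (Fin n) ℂ) (hg : ∀ i j, g i j = if i = σ j then e j else 0) :
    columnPermMatrix π * g = g * columnPermMatrix π := by
  ext i j
  simp [Matrix.mul_apply, columnPermMatrix, hg, hπσ, he]

lemma monomial_comm {h g : Matrix (Fin n) (Fin n) ℂ} {τ σ : Equiv.Perm (Fin n)} {d e : Fin n → ℂ}
    (hd : ∀ j, d j ≠ 0) (he : ∀ j, e j ≠ 0)
    (hh : ∀ i j, h i j = if i = τ j then d j else 0)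
    (hg : ∀ i j, g i j = if i = σ j then e j else 0) (hcomm : h * g = g * h) (j : Fin n) :
    τ (σ j) = σ (τ j) ∧ d (σ j) * e j = e (τ j) * d j := by
  have key := congrFun (congrFun hcomm (τ (σ j))) j
  simp only [Matrix.mul_apply, hh, hg, mul_ite, mul_zero, ite_mul, zero_mul] at key
  simp at key
  by_cases hc : τ (σ j) = σ (τ j)
  · exact ⟨hc, by simpa [hc] using key⟩
  · simp [hc, hd, he] at key

lemma ne_zero_of_pow_eq_one_of_pos {r : ℕ} (hr : 0 < r) {z : ℂ} (hz : z ^ r = 1) : z ≠ 0 := by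
  rintro rfl
  simp [hr.ne'] at hz

lemma detOn_comp (f g : EuclideanSpace ℂ (Fin n) →ₗ[ℂ] EuclideanSpace ℂ (Fin n))
    (W : Submodule ℂ (EuclideanSpace ℂ (Fin n)))
    (hf : ∀ x ∈ W, f x ∈ W) (hg : ∀ x ∈ W, g x ∈ W) :
    detOn (f ∘ₗ g) W = detOn f W * detOn g W := by
  have hfg : ∀ x ∈ W, (f ∘ₗ g) x ∈ W := fun x hx => hf _ (hg x hx)
  rw [detOn, detOn, detOn, dif_pos hf, dif_pos hg, dif_pos hfg, ← LinearMap.det_comp]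
  rfl

lemma detOn_id (W : Submodule ℂ (EuclideanSpace ℂ (Fin n))) : detOn LinearMap.id W = 1 := by
  have h : ∀ x ∈ W, (LinearMap.id : EuclideanSpace ℂ (Fin n) →ₗ[ℂ] _) x ∈ W := fun x hx => hx
  rw [detOn, dif_pos h]
  exact LinearMap.det_id

lemma detOn_congr {f g : EuclideanSpace ℂ (Fin n) →ₗ[ℂ] EuclideanSpace ℂ (Fin n)}
    {W : Submodule ℂ (EuclideanSpace ℂ (Fin n))} (hfg : ∀ x ∈ W, f x = g x)
    (hg : ∀ x ∈ W, g x ∈ W) :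
    detOn f W = detOn g W := by
  have hf : ∀ x ∈ W, f x ∈ W := fun x hx => hfg x hx ▸ hg x hx
  rw [detOn, detOn, dif_pos hf, dif_pos hg]
  congr 1
  ext x
  simp [hfg x x.2]

lemma three_le_swap_iff {a c : Fin n} (ha : (a : ℕ) < 3) (hc : (c : ℕ) < 3) (t : Fin n) :
    3 ≤ (Equiv.swap a c t : ℕ) ↔ 3 ≤ (t : ℕ) := by
  rw [Equiv.swap_apply_def]
  split_ifs with h1 h2
  · subst h1; omega
  · subst h2; omega
  · rfl

end PermutationMatrices

section ThreeCycle

variable {n : ℕ} [NeZero n]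

/-- The three-cycle `0 ↦ 1 ↦ 2 ↦ 0`. -/
def threeCycle (n : ℕ) [NeZero n] : Equiv.Perm (Fin n) :=
  (Equiv.swap (0 : Fin n) 1).trans (Equiv.swap (0 : Fin n) 2)

lemma val_one_of_three_le (hn : 3 ≤ n) : ((1 : Fin n) : ℕ) = 1 := by
  rw [Fin.val_one', Nat.mod_eq_of_lt (by omega)]

lemma val_two_of_three_le (hn : 3 ≤ n) : ((2 : Fin n) : ℕ) = 2 := by
  change 2 % n = 2
  exact Nat.mod_eq_of_lt (by omega)

lemma lt_three_iff (hn : 3 ≤ n) (t : Fin n) : (t : ℕ) < 3 ↔ t = 0 ∨ t = 1 ∨ t = 2 := by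
  simp only [Fin.ext_iff, val_one_of_three_le hn, val_two_of_three_le hn, Fin.val_zero]
  omega

lemma zero_ne_one_of_three_le (hn : 3 ≤ n) : (0 : Fin n) ≠ 1 := by
  rw [Ne, Fin.ext_iff, Fin.val_zero, val_one_of_three_le hn]
  omega

lemma zero_ne_two_of_three_le (hn : 3 ≤ n) : (0 : Fin n) ≠ 2 := by
  rw [Ne, Fin.ext_iff, Fin.val_zero, val_two_of_three_le hn]
  omega

lemma one_ne_two_of_three_le (hn : 3 ≤ n) : (1 : Fin n) ≠ 2 := by
  rw [Ne, Fin.ext_iff, val_one_of_three_le hn, val_two_of_three_le hn]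
  omega

lemma threeCycle_zero (hn : 3 ≤ n) : threeCycle n 0 = 1 := by
  simp [threeCycle, Equiv.swap_apply_of_ne_of_ne (zero_ne_one_of_three_le hn).symm
    (one_ne_two_of_three_le hn)]

lemma threeCycle_one : threeCycle n 1 = 2 := by
  simp [threeCycle]

lemma threeCycle_two (hn : 3 ≤ n) : threeCycle n 2 = 0 := by
  simp [threeCycle, Equiv.swap_apply_of_ne_of_ne (zero_ne_two_of_three_le hn).symm
    (one_ne_two_of_three_le hn).symm]

lemma threeCycle_of_le (hn : 3 ≤ n) {t : Fin n} (ht : 3 ≤ (t : ℕ)) : threeCycle n t = t := by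
  have h := (lt_three_iff hn t).not.1 (by omega)
  push Not at h
  simp [threeCycle, Equiv.swap_apply_of_ne_of_ne h.1 h.2.1, Equiv.swap_apply_of_ne_of_ne h.1 h.2.2]

lemma threeCycle_apply_eq_self_iff (hn : 3 ≤ n) (t : Fin n) :
    threeCycle n t = t ↔ 3 ≤ (t : ℕ) := by
  refine ⟨fun h => ?_, threeCycle_of_le hn⟩
  by_contra hlt
  obtain rfl | rfl | rfl := (lt_three_iff hn t).1 (by omega)
  · exact zero_ne_one_of_three_le hn (h.symm.trans (threeCycle_zero hn))
  · exact one_ne_two_of_three_le hn (h.symm.trans threeCycle_one)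
  · exact zero_ne_two_of_three_le hn ((threeCycle_two hn).symm.trans h)

lemma threeCycle_pow_three (hn : 3 ≤ n) :
    threeCycle n * (threeCycle n * threeCycle n) = 1 := by
  ext t : 1
  simp only [Equiv.Perm.mul_apply, Equiv.Perm.one_apply]
  by_cases ht : (t : ℕ) < 3
  · obtain rfl | rfl | rfl := (lt_three_iff hn t).1 ht <;>
      simp only [threeCycle_zero hn, threeCycle_one, threeCycle_two hn]
  · simp only [threeCycle_of_le hn (not_lt.1 ht)]

lemma filter_lt_three (hn : 3 ≤ n) :
    (Finset.univ.filter fun t : Fin n => (t : ℕ) < 3) = {0, 1, 2} := by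
  ext t
  simp [lt_three_iff hn]

lemma sum_filter_lt_three {M : Type*} [AddCommMonoid M] (hn : 3 ≤ n) (F : Fin n → M) :
    ∑ t ∈ Finset.univ.filter (fun t : Fin n => (t : ℕ) < 3), F t = F 0 + F 1 + F 2 := by
  rw [filter_lt_three hn, Finset.sum_insert, Finset.sum_insert, Finset.sum_singleton, add_assoc]
  · simpa using one_ne_two_of_three_le hn
  · rw [Finset.mem_insert, Finset.mem_singleton, not_or]
    exact ⟨zero_ne_one_of_three_le hn, zero_ne_two_of_three_le hn⟩

lemma sum_eq_three_add_sum {M : Type*} [AddCommMonoid M] (hn : 3 ≤ n) (F : Fin n → M) :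
    ∑ t, F t = F 0 + F 1 + F 2 + ∑ t ∈ Finset.univ.filter (fun t : Fin n => 3 ≤ (t : ℕ)), F t := by
  rw [← sum_filter_lt_three hn,
    ← Finset.sum_filter_add_sum_filter_not Finset.univ (fun t : Fin n => (t : ℕ) < 3)]
  simp only [not_lt]

lemma comp_threeCycle_symm_iff {A : Type*} (hn : 3 ≤ n) (c : Fin n → A) :
    (∀ i, c ((threeCycle n).symm i) = c i) ↔ c 0 = c 1 ∧ c 1 = c 2 := by
  rw [(threeCycle n).surjective.forall]
  simp only [Equiv.symm_apply_apply]
  constructor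
  · intro h
    exact ⟨by simpa [threeCycle_zero hn] using h 0, by simpa [threeCycle_one] using h 1⟩
  · rintro ⟨h1, h2⟩ t
    by_cases ht : (t : ℕ) < 3
    · obtain rfl | rfl | rfl := (lt_three_iff hn t).1 ht <;>
        simp only [threeCycle_zero hn, threeCycle_one, threeCycle_two hn, h1, h2]
    · rw [threeCycle_of_le hn (not_lt.1 ht)]

lemma mem_fixedSpace_threeCycle (hn : 3 ≤ n) (x : EuclideanSpace ℂ (Fin n)) :
    x ∈ fixedSpace (columnPermMatrix (threeCycle n)) ↔ x 0 = x 1 ∧ x 1 = x 2 := by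
  rw [← comp_threeCycle_symm_iff hn fun i => x i, fixedSpace, LinearMap.mem_ker,
    LinearMap.sub_apply, sub_eq_zero, LinearMap.id_apply, PiLp.ext_iff]
  exact forall_congr' fun i => by rw [← permEnd_apply]; rfl

lemma fixedSpace_threeCycle (hn : 3 ≤ n) :
    fixedSpace (columnPermMatrix (threeCycle n)) =
      Submodule.span ℂ
        (insert
          (∑ t ∈ Finset.univ.filter fun t : Fin n => (t : ℕ) < 3,
            EuclideanSpace.single t (1 : ℂ))
          {w | ∃ t : Fin n, 3 ≤ (t : ℕ) ∧ w = EuclideanSpace.single t (1 : ℂ)}) := by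
  apply le_antisymm
  · intro x hx
    obtain ⟨h1, h2⟩ := (mem_fixedSpace_threeCycle hn x).1 hx
    have hx' : x = x 0 • (∑ t ∈ Finset.univ.filter fun t : Fin n => (t : ℕ) < 3,
        EuclideanSpace.single t (1 : ℂ)) +
        ∑ t ∈ Finset.univ.filter (fun t : Fin n => 3 ≤ (t : ℕ)),
          x t • EuclideanSpace.single t (1 : ℂ) := by
      have hsum : x = ∑ t, x t • EuclideanSpace.single t (1 : ℂ) := by
        ext i
        simp [Pi.single_apply]
      conv_lhs => rw [hsum, sum_eq_three_add_sum hn]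
      rw [sum_filter_lt_three hn, smul_add, smul_add, ← h2, ← h1]
    rw [hx']
    refine Submodule.add_mem _ (Submodule.smul_mem _ _ (Submodule.subset_span (Or.inl rfl)))
      (Submodule.sum_mem _ fun t ht => Submodule.smul_mem _ _ (Submodule.subset_span (Or.inr ?_)))
    exact ⟨t, (Finset.mem_filter.1 ht).2, rfl⟩
  · rw [Submodule.span_le]
    rintro _ (rfl | ⟨t, ht, rfl⟩)
    · rw [SetLike.mem_coe, mem_fixedSpace_threeCycle hn]
      rw [sum_filter_lt_three hn]
      simp [zero_ne_one_of_three_le hn, zero_ne_two_of_three_le hn, one_ne_two_of_three_le hn,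
        (zero_ne_one_of_three_le hn).symm, (zero_ne_two_of_three_le hn).symm,
        (one_ne_two_of_three_le hn).symm]
    · have h := (lt_three_iff hn t).not.1 (by omega)
      push Not at h
      rw [SetLike.mem_coe, mem_fixedSpace_threeCycle hn]
      simp [h.1.symm, h.2.1.symm, h.2.2.symm]

lemma mem_fixedSpace_threeCycle_orthogonal (hn : 3 ≤ n) (x : EuclideanSpace ℂ (Fin n)) :
    x ∈ (fixedSpace (columnPermMatrix (threeCycle n)))ᗮ ↔
      ∑ t, x t = 0 ∧ ∀ t : Fin n, 3 ≤ (t : ℕ) → x t = 0 := by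
  rw [Submodule.mem_orthogonal]
  constructor
  · intro h
    constructor
    · have := h (WithLp.toLp 2 fun _ => 1) ((mem_fixedSpace_threeCycle hn _).2 ⟨rfl, rfl⟩)
      simpa [PiLp.inner_apply] using this
    · intro t ht
      have := h (EuclideanSpace.single t 1) (by
        rw [fixedSpace_threeCycle hn]
        exact Submodule.subset_span (Or.inr ⟨t, ht, rfl⟩))
      simpa [EuclideanSpace.inner_single_left] using this
  · rintro ⟨h, h0⟩ u hu
    obtain ⟨h1, h2⟩ := (mem_fixedSpace_threeCycle hn u).1 hu
    have hzero (c : Fin n → ℂ) :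
        ∑ t ∈ Finset.univ.filter (fun t : Fin n => 3 ≤ (t : ℕ)), x t * c t = 0 :=
      Finset.sum_eq_zero fun t ht => by rw [h0 t (Finset.mem_filter.1 ht).2, zero_mul]
    have hx := hzero fun _ => 1
    simp only [mul_one] at hx
    rw [sum_eq_three_add_sum hn, hx, add_zero] at h
    simp only [PiLp.inner_apply, RCLike.inner_apply]
    rw [sum_eq_three_add_sum hn, hzero, add_zero, ← h2, ← h1, ← add_mul, ← add_mul, h, zero_mul]

lemma permEnd_mem_orthogonal (hn : 3 ≤ n) (π : Equiv.Perm (Fin n))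
    (hπ : ∀ t, 3 ≤ (π t : ℕ) ↔ 3 ≤ (t : ℕ)) :
    ∀ x ∈ (fixedSpace (columnPermMatrix (threeCycle n)))ᗮ,
      permEnd π x ∈ (fixedSpace (columnPermMatrix (threeCycle n)))ᗮ := by
  intro x hx
  rw [mem_fixedSpace_threeCycle_orthogonal hn] at hx ⊢
  simp only [permEnd_apply]
  exact ⟨(Equiv.sum_comp π.symm fun t => x t).trans hx.1,
    fun t ht => hx.2 _ (by rwa [← hπ, Equiv.apply_symm_apply])⟩

lemma detOn_permEnd_mul (hn : 3 ≤ n) (π τ : Equiv.Perm (Fin n))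
    (hπ : ∀ t, 3 ≤ (π t : ℕ) ↔ 3 ≤ (t : ℕ)) (hτ : ∀ t, 3 ≤ (τ t : ℕ) ↔ 3 ≤ (t : ℕ)) :
    detOn (permEnd (π * τ)) (fixedSpace (columnPermMatrix (threeCycle n)))ᗮ =
      detOn (permEnd π) (fixedSpace (columnPermMatrix (threeCycle n)))ᗮ *
        detOn (permEnd τ) (fixedSpace (columnPermMatrix (threeCycle n)))ᗮ := by
  rw [permEnd_mul, detOn_comp _ _ _ (permEnd_mem_orthogonal hn π hπ)
    (permEnd_mem_orthogonal hn τ hτ)]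

lemma three_le_threeCycle_iff (hn : 3 ≤ n) (t : Fin n) :
    3 ≤ (threeCycle n t : ℕ) ↔ 3 ≤ (t : ℕ) := by
  rw [← threeCycle_apply_eq_self_iff hn, ← threeCycle_apply_eq_self_iff hn,
    (threeCycle n).injective.eq_iff]

lemma detOn_threeCycle (hn : 3 ≤ n) :
    detOn (permEnd (threeCycle n)) (fixedSpace (columnPermMatrix (threeCycle n)))ᗮ = 1 := by
  have h0 : ((0 : Fin n) : ℕ) < 3 := by simp
  have h1 : ((1 : Fin n) : ℕ) < 3 := by rw [val_one_of_three_le hn]; omega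
  have h2 : ((2 : Fin n) : ℕ) < 3 := by rw [val_two_of_three_le hn]; omega
  have hs {a c : Fin n} (ha : (a : ℕ) < 3) (hc : (c : ℕ) < 3) :=
    detOn_permEnd_mul hn (Equiv.swap a c) (Equiv.swap a c) (three_le_swap_iff ha hc)
      (three_le_swap_iff ha hc)
  simp only [Equiv.swap_mul_self, permEnd_one, detOn_id] at hs
  have hσ : threeCycle n = Equiv.swap 0 2 * Equiv.swap 0 1 := rfl
  have hmul := detOn_permEnd_mul hn _ _ (three_le_swap_iff h0 h2) (three_le_swap_iff h0 h1)
  rw [← hσ] at hmul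
  have hσ2 := detOn_permEnd_mul hn _ _ (three_le_threeCycle_iff hn) (three_le_threeCycle_iff hn)
  have hσ3 := detOn_permEnd_mul hn (threeCycle n) (threeCycle n * threeCycle n)
    (three_le_threeCycle_iff hn)
    (fun t => (three_le_threeCycle_iff hn _).trans (three_le_threeCycle_iff hn t))
  rw [threeCycle_pow_three hn, permEnd_one, detOn_id, hσ2] at hσ3
  have ha := hs h0 h1
  have hb := hs h0 h2
  have hsq : detOn (permEnd (threeCycle n)) (fixedSpace (columnPermMatrix (threeCycle n)))ᗮ *
      detOn (permEnd (threeCycle n)) (fixedSpace (columnPermMatrix (threeCycle n)))ᗮ = 1 := by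
    rw [hmul, mul_mul_mul_comm, ← ha, ← hb, one_mul]
  rw [hsq, mul_one] at hσ3
  exact hσ3.symm

lemma three_le_iff_of_comm (hn : 3 ≤ n) {τ : Equiv.Perm (Fin n)}
    (hτ : ∀ j, τ (threeCycle n j) = threeCycle n (τ j)) (t : Fin n) :
    3 ≤ (τ t : ℕ) ↔ 3 ≤ (t : ℕ) := by
  rw [← threeCycle_apply_eq_self_iff hn, ← threeCycle_apply_eq_self_iff hn, ← hτ,
    τ.injective.eq_iff]

lemma detOn_permEnd_congr (hn : 3 ≤ n) {π τ : Equiv.Perm (Fin n)}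
    (hπ : ∀ t, 3 ≤ (π t : ℕ) ↔ 3 ≤ (t : ℕ)) (hτ : ∀ t, 3 ≤ (τ t : ℕ) ↔ 3 ≤ (t : ℕ))
    (h0 : τ 0 = π 0) (h1 : τ 1 = π 1) (h2 : τ 2 = π 2) :
    detOn (permEnd τ) (fixedSpace (columnPermMatrix (threeCycle n)))ᗮ =
      detOn (permEnd π) (fixedSpace (columnPermMatrix (threeCycle n)))ᗮ := by
  refine detOn_congr (fun x hx => ?_) (permEnd_mem_orthogonal hn π hπ)
  have hx0 := ((mem_fixedSpace_threeCycle_orthogonal hn x).1 hx).2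
  ext i
  rw [permEnd_apply, permEnd_apply]
  obtain ⟨j, rfl⟩ := τ.surjective i
  by_cases hj : (j : ℕ) < 3
  · have hπτ : τ j = π j := by
      obtain rfl | rfl | rfl := (lt_three_iff hn j).1 hj <;> assumption
    rw [Equiv.symm_apply_apply, hπτ, Equiv.symm_apply_apply]
  · rw [Equiv.symm_apply_apply, hx0 j (not_lt.1 hj), hx0]
    rw [← hπ, Equiv.apply_symm_apply, hτ]
    exact not_lt.1 hj

lemma detOn_permEnd_of_comm (hn : 3 ≤ n) {τ : Equiv.Perm (Fin n)}
    (hτ : ∀ j, τ (threeCycle n j) = threeCycle n (τ j)) :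
    detOn (permEnd τ) (fixedSpace (columnPermMatrix (threeCycle n)))ᗮ = 1 := by
  have hτ3 := three_le_iff_of_comm hn hτ
  have hτ1 : τ 1 = threeCycle n (τ 0) := by rw [← hτ, threeCycle_zero hn]
  have hτ2 : τ 2 = threeCycle n (τ 1) := by rw [← hτ, threeCycle_one]
  have hσ3 := three_le_threeCycle_iff hn
  have hτ0 : (τ 0 : ℕ) < 3 := by
    have := (hτ3 0).not.2 (by simp)
    omega
  obtain h | h | h := (lt_three_iff hn _).1 hτ0
  · rw [detOn_permEnd_congr hn (π := 1) (fun _ => Iff.rfl) hτ3, permEnd_one, detOn_id] <;>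
      simp [hτ2, hτ1, h, threeCycle_zero hn, threeCycle_one]
  · rw [detOn_permEnd_congr hn hσ3 hτ3, detOn_threeCycle hn] <;>
      simp [hτ2, hτ1, h, threeCycle_zero hn, threeCycle_one]
  · rw [detOn_permEnd_congr hn (π := threeCycle n * threeCycle n)
      (fun t => (hσ3 _).trans (hσ3 t)) hτ3, detOn_permEnd_mul hn _ _ hσ3 hσ3,
      detOn_threeCycle hn, mul_one] <;>
      simp [hτ2, hτ1, h, threeCycle_zero hn, threeCycle_one, threeCycle_two hn]

lemma rename_three_sum_of_comm (hn : 3 ≤ n) {τ : Equiv.Perm (Fin n)}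
    (hτ : ∀ j, τ (threeCycle n j) = threeCycle n (τ j)) :
    rename τ (X 0 + X 1 + X 2 : MvPolynomial (Fin n) ℂ) = X 0 + X 1 + X 2 := by
  have hτ1 : τ 1 = threeCycle n (τ 0) := by rw [← hτ, threeCycle_zero hn]
  have hτ2 : τ 2 = threeCycle n (τ 1) := by rw [← hτ, threeCycle_one]
  have hτ0 : (τ 0 : ℕ) < 3 := by
    have := (three_le_iff_of_comm hn hτ 0).not.2 (by simp)
    omega
  simp only [map_add, rename_X]
  obtain h | h | h := (lt_three_iff hn _).1 hτ0 <;>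
    simp only [hτ2, hτ1, h, threeCycle_zero hn, threeCycle_one, threeCycle_two hn] <;> ring

lemma SVg_threeCycle (hn : 3 ≤ n) :
    SVg (columnPermMatrix (threeCycle n)) =
      Algebra.adjoin ℂ (insert (X 0 + X 1 + X 2) {q | ∃ t : Fin n, 3 ≤ (t : ℕ) ∧ q = X t}) := by
  have hfix (c : Fin n → ℂ) :
      (columnPermMatrix (threeCycle n)).mulVec c = c ↔ c 0 = c 1 ∧ c 1 = c 2 := by
    rw [← comp_threeCycle_symm_iff hn, funext_iff]
    exact forall_congr' fun i => by rw [columnPermMatrix_mulVec]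
  apply le_antisymm <;> rw [SVg] <;> apply Algebra.adjoin_le
  · rintro _ ⟨c, hc, rfl⟩
    obtain ⟨h1, h2⟩ := (hfix c).1 hc
    rw [sum_eq_three_add_sum hn, ← h2, ← h1, ← mul_add, ← mul_add]
    rw [SetLike.mem_coe]
    simp only [← MvPolynomial.smul_eq_C_mul]
    refine Subalgebra.add_mem _ (Subalgebra.smul_mem _ (Algebra.subset_adjoin ?_) _)
      (Subalgebra.sum_mem _ fun t ht => Subalgebra.smul_mem _ (Algebra.subset_adjoin ?_) _)
    · exact Or.inl rfl
    · exact Or.inr ⟨t, (Finset.mem_filter.1 ht).2, rfl⟩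
  · rintro _ (rfl | ⟨t, ht, rfl⟩)
    · refine Algebra.subset_adjoin ⟨fun i => if (i : ℕ) < 3 then 1 else 0, (hfix _).2 ?_, ?_⟩
      · simp only [Fin.val_zero, val_one_of_three_le hn, val_two_of_three_le hn]
        norm_num
      · rw [← sum_filter_lt_three hn, Finset.sum_filter]
        exact Finset.sum_congr rfl fun i _ => by split_ifs with h <;> simp [h]
    · have h := (lt_three_iff hn t).not.1 (by omega)
      push Not at h
      refine Algebra.subset_adjoin ⟨Pi.single t 1, (hfix _).2 ?_, ?_⟩
      · simp [h.1.symm, h.2.1.symm, h.2.2.symm]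
      · simp [Pi.single_apply]

end ThreeCycle

/-- Assume `n ≥ 3` and let `G = G(r,1,n)` act on `V = ℂⁿ` via the
nonfaithful representation `ρ` (realized by `act ∘ rho`).  Let `g = g_A ⊕ g_B`, where
`g_A` is a `3×3` diagonal matrix (entries `dA`, `r`-th roots of unity) times the 3-cycle
`(1,2,3)`, and `g_B = ξ^{c₁}I_{m₁} ⊕ ⋯ ⊕ ξ^{c_k}I_{m_k}` is block-scalar on the last
`n−3` coordinates with `ξ^{c_i}` pairwise distinct (blocks = fibers of `b` on `{t ≥ 3}`,
of cardinalities `m i ≥ 1`).  Then: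
(a) the fixed space `V^g` of `ρ(g)` is spanned by `v₁+v₂+v₃, v₄, …, v_n`;
(b) the Hochschild character `χ_g` of `Z(g)` is trivial; and
(c) `S(V^g)^{χ_g} = S(V^g)^{Z(g)} = ℂ[f₀, f⁽ⁱ⁾_l]`, where `f₀ = v₁+v₂+v₃` and `f⁽ⁱ⁾_l`
is the `l`-th elementary symmetric polynomial in the variables of the `i`-th block. -/
theorem nonfaithful_data_for_three_cycle_times_diagonal
    (r n : ℕ) [NeZero n] (hn : 3 ≤ n) (hr : 0 < r)
    (ξ : ℂ) (hξ : IsPrimitiveRoot ξ r)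
    (dA : Fin n → ℂ) (hdA : ∀ t, dA t ^ r = 1)
    (k : ℕ) (c : Fin k → ℕ) (hdist : Function.Injective fun i => ξ ^ c i)
    (b : Fin n → Fin k)
    (hb : ∀ t s : Fin n, 3 ≤ (t : ℕ) → 3 ≤ (s : ℕ) → t ≤ s → b t ≤ b s)
    (m : Fin k → ℕ) (hmpos : ∀ i, 0 < m i)
    (hm : ∀ i, (Finset.univ.filter fun t : Fin n => 3 ≤ (t : ℕ) ∧ b t = i).card = m i)
    (g : Matrix (Fin n) (Fin n) ℂ)
    (hg : g = Matrix.of fun i j : Fin n =>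
        if i = ((Equiv.swap (0 : Fin n) 1).trans (Equiv.swap (0 : Fin n) 2)) j then
          (if (j : ℕ) < 3 then dA j else ξ ^ c (b j))
        else 0) :
    fixedSpace (rho g)
        = Submodule.span ℂ
            (insert
              (∑ t ∈ Finset.univ.filter fun t : Fin n => (t : ℕ) < 3,
                EuclideanSpace.single t (1 : ℂ))
              {w | ∃ t : Fin n, 3 ≤ (t : ℕ) ∧ w = EuclideanSpace.single t (1 : ℂ)})
    ∧ (∀ h ∈ GG r 1 n, h * g = g * h → chi (rho g) (rho h) = 1)
    ∧ ({f : MvPolynomial (Fin n) ℂ |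
          f ∈ SVg (rho g) ∧
            ∀ h ∈ GG r 1 n, h * g = g * h →
              act (rho h) f = chi (rho g) (rho h) • f}
        = {f | f ∈ SVg (rho g) ∧
            ∀ h ∈ GG r 1 n, h * g = g * h → act (rho h) f = f})
    ∧ {f : MvPolynomial (Fin n) ℂ |
          f ∈ SVg (rho g) ∧
            ∀ h ∈ GG r 1 n, h * g = g * h → act (rho h) f = f}
        = ↑(Algebra.adjoin ℂ
            (insert (X (0 : Fin n) + X 1 + X 2)
              {q : MvPolynomial (Fin n) ℂ | ∃ (i : Fin k) (l : ℕ), 1 ≤ l ∧ l ≤ m i ∧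
                q = ∑ s ∈ Finset.powersetCard l
                      (Finset.univ.filter fun t : Fin n => 3 ≤ (t : ℕ) ∧ b t = i),
                    ∏ t ∈ s, X t})) := by
  have hσ : g = Matrix.of fun i j : Fin n => if i = threeCycle n j then
      (if (j : ℕ) < 3 then dA j else ξ ^ c (b j)) else 0 := hg
  set e : Fin n → ℂ := fun j => if (j : ℕ) < 3 then dA j else ξ ^ c (b j) with he_def
  have he : ∀ j, e j ≠ 0 := by
    intro j
    simp only [he_def]
    split_ifs
    · exact ne_zero_of_pow_eq_one_of_pos hr (hdA j)
    · exact pow_ne_zero _ (hξ.ne_zero hr.ne')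
  have hge : ∀ i j, g i j = if i = threeCycle n j then e j else 0 := fun i j => by rw [hσ]; rfl
  have hrho : rho g = columnPermMatrix (threeCycle n) := rho_monomial g _ e he hge
  set B : Fin k → Finset (Fin n) :=
    fun i => Finset.univ.filter fun t : Fin n => 3 ≤ (t : ℕ) ∧ b t = i with hB_def
  have hmemB : ∀ i t, t ∈ B i ↔ 3 ≤ (t : ℕ) ∧ b t = i := fun i t => by simp [hB_def]
  have hcent : ∀ h ∈ GG r 1 n, h * g = g * h → ∃ τ : Equiv.Perm (Fin n),
      rho h = columnPermMatrix τ ∧ (∀ j, τ (threeCycle n j) = threeCycle n (τ j)) ∧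
        ∀ i t, τ t ∈ B i ↔ t ∈ B i := by
    rintro h ⟨⟨τ, d, hd, hh⟩, -⟩ hcomm
    have hd0 : ∀ j, d j ≠ 0 := fun j => ne_zero_of_pow_eq_one_of_pos hr (hd j)
    have key := monomial_comm hd0 he hh hge hcomm
    have hτ : ∀ j, τ (threeCycle n j) = threeCycle n (τ j) := fun j => (key j).1
    refine ⟨τ, rho_monomial h τ d hd0 hh, hτ, fun i t => ?_⟩
    rw [hmemB, hmemB, three_le_iff_of_comm hn hτ]
    refine and_congr_right fun ht => ?_
    have hk := (key t).2
    rw [threeCycle_of_le hn ht, mul_comm] at hk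
    have hk' := mul_right_cancel₀ (hd0 t) hk
    have ht' := (three_le_iff_of_comm hn hτ t).2 ht
    simp only [he_def, not_lt.2 ht, not_lt.2 ht', if_false] at hk'
    rw [hdist hk']
  have hchi : ∀ h ∈ GG r 1 n, h * g = g * h → chi (rho g) (rho h) = 1 := by
    intro h hh hcomm
    obtain ⟨τ, hτ, hτσ, -⟩ := hcent h hh hcomm
    rw [hrho, hτ]
    exact detOn_permEnd_of_comm hn hτσ
  refine ⟨by rw [hrho, fixedSpace_threeCycle hn], hchi, ?_, ?_⟩
  · ext f
    refine and_congr_right fun _ => forall₃_congr fun h hh hcomm => ?_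
    rw [hchi h hh hcomm, one_smul]
  · ext f
    rw [Set.mem_ofPred_eq, SetLike.mem_coe, hrho, SVg_threeCycle hn]
    constructor
    · rintro ⟨hf, hinv⟩
      have hperm (i : Fin k) (π : Equiv.Perm (Fin n)) (hB : ∀ t, π t ∈ B i ↔ t ∈ B i)
          (hfix : ∀ t, t ∉ B i → π t = t) (j : Fin n) :
          π (threeCycle n j) = threeCycle n (π j) ∧ e (π j) = e j := by
        by_cases hj : j ∈ B i
        · have hj' := (hB j).2 hj
          rw [hmemB] at hj hj'
          rw [threeCycle_of_le hn hj.1, threeCycle_of_le hn hj'.1]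
          simp only [he_def, not_lt.2 hj.1, not_lt.2 hj'.1, hj.2, hj'.2, if_false, and_self]
        · have hj' : threeCycle n j ∉ B i := by
            by_cases hlt : 3 ≤ (j : ℕ)
            · rwa [threeCycle_of_le hn hlt]
            · rw [hmemB, three_le_threeCycle_iff hn]
              exact fun h => hlt h.1
          rw [hfix j hj, hfix _ hj']
          exact ⟨rfl, rfl⟩
      refine Algebra.adjoin_mono ?_ (mem_adjoin_blockEsymm_of_blockInvariant B ?_
        {X 0 + X 1 + X 2} ?_ (Algebra.adjoin_mono ?_ hf) ?_)
      · rintro _ (rfl | ⟨i, l, h1, h2, rfl⟩)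
        · exact Or.inl rfl
        · exact Or.inr ⟨i, l, h1, h2.trans_eq (hm i), rfl⟩
      · intro i j hij
        refine Finset.disjoint_left.2 fun t hi hj => hij ?_
        rw [← ((hmemB i t).1 hi).2, ((hmemB j t).1 hj).2]
      · rintro _ rfl i π
        exact rename_three_sum_of_comm hn fun j => (hperm i _
          (Equiv.Perm.ofSubtype_apply_mem_iff_mem π)
          (fun _ => Equiv.Perm.ofSubtype_apply_of_not_mem π) j).1
      · rintro _ (rfl | ⟨t, ht, rfl⟩)
        · exact Or.inl rfl
        · exact Or.inr ⟨b t, t, (hmemB _ _).2 ⟨ht, rfl⟩, rfl⟩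
      · intro i π
        have hπ := hperm i _ (Equiv.Perm.ofSubtype_apply_mem_iff_mem π)
          (fun _ => Equiv.Perm.ofSubtype_apply_of_not_mem π)
        have h := hinv _ (columnPermMatrix_mem_GG r _)
          (columnPermMatrix_mul_comm_monomial _ _ e (fun j => (hπ j).1)
            (fun j => (hπ j).2) g hge)
        rwa [rho_monomial (columnPermMatrix _) _ (fun _ => 1)
          (fun _ => one_ne_zero) (fun _ _ => rfl), act_columnPermMatrix] at h
    · intro hf
      constructor
      · refine Algebra.adjoin_le ?_ hf
        rintro _ (rfl | ⟨i, l, -, -, rfl⟩)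
        · exact Algebra.subset_adjoin (Set.mem_insert _ _)
        · refine Subalgebra.sum_mem _ fun s hs => Subalgebra.prod_mem _ fun t ht =>
            Algebra.subset_adjoin (Set.mem_insert_of_mem _ ⟨t, ?_, rfl⟩)
          exact ((hmemB i t).1 ((Finset.mem_powersetCard.1 hs).1 ht)).1
      · intro h hh hcomm
        obtain ⟨τ, hτ, hτσ, hτB⟩ := hcent h hh hcomm
        rw [hτ, act_columnPermMatrix]
        refine (Algebra.adjoin_le (S := AlgHom.equalizer (rename τ) (AlgHom.id ℂ _)) ?_) hf
        rintro _ (rfl | ⟨i, l, -, -, rfl⟩)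
        · exact rename_three_sum_of_comm hn hτσ
        · exact rename_blockEsymm (B i) l τ (hτB i)

end
end

section
/- Let A be an associative (unital) ℂ-algebra and let μ : A × A → A be a ℂ-bilinear map satisfying the Hochschild 2-cocycle condition a·μ(b,c) + μ(a,bc) = μ(ab,c) + μ(a,b)·c for all a, b, c ∈ A. For x, y ∈ A write ⟨x,y⟩ = μ(x,y) − μ(y,x) and [x,y] = xy − yx. Then for any u, v, w ∈ A which pairwise commute (uv = vu, vw = wv, uw = wu), the Jacobi-type identity holds: [u,⟨v,w⟩] + [v,⟨w,u⟩] + [w,⟨u,v⟩] = 0. -/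
/-- Let `A` be an associative unital `ℂ`-algebra and `μ : A × A → A` a
`ℂ`-bilinear map satisfying the Hochschild 2-cocycle condition
`a·μ(b,c) + μ(a,bc) = μ(ab,c) + μ(a,b)·c`.  Writing `⟨x,y⟩ = μ(x,y) − μ(y,x)` and
`[x,y] = xy − yx`, for any pairwise commuting `u,v,w ∈ A` the Jacobi-type identity
`[u,⟨v,w⟩] + [v,⟨w,u⟩] + [w,⟨u,v⟩] = 0` holds. -/
theorem hochschild_two_cocycle_jacobi_identity
    (A : Type*) [Ring A] [Algebra ℂ A]
    (μ : A →ₗ[ℂ] A →ₗ[ℂ] A)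
    (hcocycle : ∀ a b c : A, a * μ b c + μ a (b * c) = μ (a * b) c + μ a b * c)
    (u v w : A) (huv : u * v = v * u) (hvw : v * w = w * v) (huw : u * w = w * u) :
    (u * (μ v w - μ w v) - (μ v w - μ w v) * u)
      + (v * (μ w u - μ u w) - (μ w u - μ u w) * v)
      + (w * (μ u v - μ v u) - (μ u v - μ v u) * w) = 0 := by
  have h₁ := hcocycle u v w
  have h₂ := hcocycle v w u
  have h₃ := hcocycle w u v
  have h₄ := hcocycle u w v
  have h₅ := hcocycle w v u
  have h₆ := hcocycle v u w
  rw [← hvw] at h₄ h₅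
  rw [← huw] at h₂ h₃
  rw [← huv] at h₅ h₆
  linear_combination (norm := noncomm_ring) h₁ + h₂ + h₃ - h₄ - h₅ - h₆
end

section
/- Assume n ≥ 4 and let g = (1,2,3) (the permutation matrix of the 3-cycle) in G(r,p,n). Then the centralizer of g in G(r,p,n) is Z(g) = {h_A ⊕ h_B : h_A ∈ ⟨ξI_3, (1,2,3)⟩ ≤ G(r,1,3), h_B ∈ G(r,1,n−3)} ∩ G(r,p,n), where the block decomposition is with respect to the coordinates {1,2,3} and {4,…,n} and ⟨ξI_3, (1,2,3)⟩ is the subgroup of G(r,1,3) generated by the scalar matrix ξI_3 and the permutation matrix (1,2,3). -/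
open MvPolynomial Matrix Finset

attribute [local instance] Classical.propDecidable

noncomputable section

/-- The 3-cycle `(1,2,3)` as a permutation of `Fin n` (sending `1 ↦ 2 ↦ 3 ↦ 1`). -/
def sigma3 (n : ℕ) [NeZero n] : Equiv.Perm (Fin n) :=
  (Equiv.swap (0 : Fin n) 1).trans (Equiv.swap (0 : Fin n) 2)

/-- The permutation matrix of the 3-cycle `(1,2,3)`. -/
def g123 (n : ℕ) [NeZero n] : Matrix (Fin n) (Fin n) ℂ :=
  Matrix.of fun i j : Fin n => if i = sigma3 n j then 1 else 0

theorem sigma3_apply_val (n : ℕ) [NeZero n] (hn : 3 ≤ n) (x : Fin n) :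
    (sigma3 n x : ℕ) = if (x : ℕ) = 0 then (1 : ℕ) else if (x : ℕ) = 1 then 2
      else if (x : ℕ) = 2 then 0 else (x : ℕ) := by
  obtain ⟨m, rfl⟩ : ∃ m, n = m + 3 := ⟨n - 3, by omega⟩
  have h0 : ((0 : Fin (m + 3)) : ℕ) = 0 := rfl
  have h1 : ((1 : Fin (m + 3)) : ℕ) = 1 := rfl
  have h2 : ((2 : Fin (m + 3)) : ℕ) = 2 := rfl
  simp only [sigma3, Equiv.trans_apply, Equiv.swap_apply_def, Fin.ext_iff, apply_ite Fin.val,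
    h0, h1, h2]
  split_ifs <;> first | rfl | contradiction

theorem sigma3_apply_val_lt_three_iff (n : ℕ) [NeZero n] (hn : 3 ≤ n) (x : Fin n) :
    (sigma3 n x : ℕ) < 3 ↔ (x : ℕ) < 3 := by
  rw [sigma3_apply_val n hn]
  split_ifs <;> omega

theorem sigma3_apply_eq_self_iff (n : ℕ) [NeZero n] (hn : 3 ≤ n) (x : Fin n) :
    sigma3 n x = x ↔ ¬ (x : ℕ) < 3 := by
  rw [Fin.ext_iff, sigma3_apply_val n hn]
  split_ifs <;> omega

theorem exists_sigma3_pow_apply_zero_eq (n : ℕ) [NeZero n] (hn : 3 ≤ n) (x : Fin n)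
    (hx : (x : ℕ) < 3) : ∃ k : ℕ, (sigma3 n ^ k) 0 = x := by
  refine ⟨x, Fin.ext ?_⟩
  have : (x : ℕ) = 0 ∨ (x : ℕ) = 1 ∨ (x : ℕ) = 2 := by omega
  rcases this with h | h | h <;>
    simp [h, pow_succ, Equiv.Perm.mul_apply, sigma3_apply_val n hn]

theorem commute_g123_iff (n : ℕ) [NeZero n] (h : Matrix (Fin n) (Fin n) ℂ) :
    h * g123 n = g123 n * h ↔ ∀ i j, h (sigma3 n i) (sigma3 n j) = h i j := by
  have hl : ∀ i j, (h * g123 n) i j = h i (sigma3 n j) := by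
    intro i j
    simp [g123, Matrix.mul_apply]
  have hr : ∀ i j, (g123 n * h) (sigma3 n i) j = h i j := by
    intro i j
    simp [g123, Matrix.mul_apply]
  constructor
  · intro H i j
    rw [← hl, H, hr]
  · intro H
    ext i j
    obtain ⟨i, rfl⟩ := (sigma3 n).surjective i
    rw [hl, hr, H]

theorem perm_commute_of_monomial_invariant {ι R : Type*} [DecidableEq ι] [Zero R]
    {h : Matrix ι ι R} {s σ : Equiv.Perm ι} {d : ι → R} (hd : ∀ j, d j ≠ 0)
    (hh : ∀ i j, h i j = if i = σ j then d j else 0)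
    (H : ∀ i j, h (s i) (s j) = h i j) (j : ι) :
    s (σ j) = σ (s j) ∧ d (s j) = d j := by
  have h1 := H (σ j) j
  rw [hh, hh, if_pos rfl] at h1
  by_cases hc : s (σ j) = σ (s j)
  · exact ⟨hc, by rwa [if_pos hc] at h1⟩
  · rw [if_neg hc] at h1
    exact absurd h1.symm (hd j)

/-- Assume `n ≥ 4` and let `g = (1,2,3)` in `G(r,p,n)`.  Then the
centralizer of `g` in `G(r,p,n)` is
`Z(g) = {h_A ⊕ h_B : h_A ∈ ⟨ξI₃, (1,2,3)⟩ ≤ G(r,1,3), h_B ∈ G(r,1,n−3)} ∩ G(r,p,n)`,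
where the block decomposition is with respect to the coordinates `{1,2,3}` and `{4,…,n}`:
an element of `G(r,p,n)` lies in `Z(g)` iff it vanishes on the off-diagonal blocks and its
top-left `3×3` block has the form `ξ^a (1,2,3)^j`.  (The bottom-right block of such an
element automatically lies in `G(r,1,n−3)`.) -/
theorem centralizer_of_three_cycle_in_Grpn
    (r p n : ℕ) [NeZero n] (hn : 4 ≤ n) (hr : 0 < r) (hp : 0 < p) (hpr : p ∣ r)
    (ξ : ℂ) (hξ : IsPrimitiveRoot ξ r) :
    Zg r p n (g123 n)
      = {h | h ∈ GG r p n ∧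
          (∀ t s : Fin n, ¬ ((t : ℕ) < 3 ↔ (s : ℕ) < 3) → h t s = 0) ∧
          ∃ a j : ℕ, ∀ t s : Fin n, (t : ℕ) < 3 → (s : ℕ) < 3 →
            h t s = ξ ^ a * (if t = (sigma3 n ^ j) s then 1 else 0)} := by
  have hn3 : 3 ≤ n := by omega
  ext h
  simp only [Zg, Set.mem_ofPred_eq, commute_g123_iff]
  refine and_congr_right fun hG => ⟨fun H => ?_, ?_⟩
  · obtain ⟨⟨σ, d, hd, hh⟩, -⟩ := hG
    have hd0 : ∀ j, d j ≠ 0 := fun j h0 => by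
      have := hd j
      rw [h0, zero_pow hr.ne'] at this
      exact zero_ne_one this
    have hc := perm_commute_of_monomial_invariant hd0 hh H
    have hσ : ∀ x, (σ x : ℕ) < 3 ↔ (x : ℕ) < 3 := fun x => by
      rw [← not_iff_not, ← sigma3_apply_eq_self_iff n hn3, ← sigma3_apply_eq_self_iff n hn3,
        (hc x).1, σ.injective.eq_iff]
    have hpow : ∀ m : ℕ, σ ((sigma3 n ^ m) 0) = (sigma3 n ^ m) (σ 0) ∧
        d ((sigma3 n ^ m) 0) = d 0 := by
      intro m
      induction m with
      | zero => simp
      | succ m ih =>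
        rw [pow_succ', Equiv.Perm.mul_apply, Equiv.Perm.mul_apply, ← (hc _).1, (hc _).2, ih.1]
        exact ⟨rfl, ih.2⟩
    refine ⟨fun t s hts => ?_, ?_⟩
    · rw [hh, if_neg]
      rintro rfl
      exact hts (hσ s)
    · have : NeZero r := ⟨hr.ne'⟩
      obtain ⟨a, -, ha⟩ := hξ.eq_pow_of_pow_eq_one (hd 0)
      obtain ⟨k, hk⟩ := exists_sigma3_pow_apply_zero_eq n hn3 (σ 0) ((hσ 0).2 (by simp))
      refine ⟨a, k, fun t s _ hs => ?_⟩
      obtain ⟨m, rfl⟩ := exists_sigma3_pow_apply_zero_eq n hn3 s hs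
      rw [hh, (hpow m).1, (hpow m).2, ← hk, ha, ← Equiv.Perm.mul_apply, ← Equiv.Perm.mul_apply,
        ← pow_add, ← pow_add, add_comm, mul_ite, mul_one, mul_zero]
  · rintro ⟨hoff, a, k, hA⟩ i j
    have hi := sigma3_apply_val_lt_three_iff n hn3 i
    have hj := sigma3_apply_val_lt_three_iff n hn3 j
    by_cases hij : (i : ℕ) < 3 ↔ (j : ℕ) < 3
    · by_cases hi3 : (i : ℕ) < 3
      · have hj3 := hij.1 hi3
        rw [hA _ _ (hi.2 hi3) (hj.2 hj3), hA _ _ hi3 hj3, ← Equiv.Perm.mul_apply, ← pow_succ,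
          pow_succ', Equiv.Perm.mul_apply]
        simp only [(sigma3 n).injective.eq_iff]
      · rw [(sigma3_apply_eq_self_iff n hn3 i).2 hi3,
          (sigma3_apply_eq_self_iff n hn3 j).2 fun h => hi3 (hij.2 h)]
    · rw [hoff i j hij, hoff]
      rwa [hi, hj]

end
end
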